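/- arXiv:2112.13087 — 2 statements merged into one kernel-verified Lean document; each statement's English description precedes it below -/
import Mathlib

section
/- Let R_s(n,k) denote the number of saturated 2-regular simple stacks on [n] with k arcs, i.e., noncrossing partial matchings on vertices 1,...,n drawn on a line, where every arc (i,j) has j-i ≥ 2, and no arc of length ≥ 2 can be added without creating a crossing, a vertex of degree 2, or an arc of length < 2. Then R_s(n,k) = (1/(k+1)) ∑_{t=1}^{k+1} C(k+1,t) C(2t+k-1,t-1) C(t, n-2k-t). -/
/-- A 2-regular simple stack on `[n]`: a set of arcs `(i,j)` with `1 ≤ i`, `j ≤ n`,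
`j - i ≥ 2` (2-regular), every vertex of degree at most 1 (simple), and no two
arcs crossing (stack). -/
def IsStack (n : ℕ) (A : Finset (ℕ × ℕ)) : Prop :=
  (∀ p ∈ A, 1 ≤ p.1 ∧ p.2 ≤ n ∧ p.1 + 2 ≤ p.2) ∧
  (∀ p ∈ A, ∀ q ∈ A, p ≠ q → p.1 ≠ q.1 ∧ p.1 ≠ q.2 ∧ p.2 ≠ q.1 ∧ p.2 ≠ q.2) ∧
  (∀ p ∈ A, ∀ q ∈ A, ¬(p.1 < q.1 ∧ q.1 < p.2 ∧ p.2 < q.2))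

/-- A stack is saturated if no arc can be added while keeping all constraints. -/
def IsSaturatedStack (n : ℕ) (A : Finset (ℕ × ℕ)) : Prop :=
  IsStack n A ∧ ∀ p : ℕ × ℕ, p ∉ A → ¬ IsStack n (insert p A)

/-- Binomial coefficient with an integer lower index, vanishing for negative lower index. -/
def chooseZ (a : ℕ) (b : ℤ) : ℕ := if 0 ≤ b then a.choose b.toNat else 0


def Stk (lo hi : ℕ) (A : Finset (ℕ × ℕ)) : Prop :=
  (∀ p ∈ A, lo ≤ p.1 ∧ p.2 < hi ∧ p.1 + 2 ≤ p.2) ∧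
  (∀ p ∈ A, ∀ q ∈ A, p ≠ q → p.1 ≠ q.1 ∧ p.1 ≠ q.2 ∧ p.2 ≠ q.1 ∧ p.2 ≠ q.2) ∧
  (∀ p ∈ A, ∀ q ∈ A, ¬(p.1 < q.1 ∧ q.1 < p.2 ∧ p.2 < q.2))

def Iso (A : Finset (ℕ × ℕ)) (v : ℕ) : Prop := ∀ p ∈ A, p.1 ≠ v ∧ p.2 ≠ v

def Sat (lo hi : ℕ) (A : Finset (ℕ × ℕ)) : Prop :=
  ∀ v w, lo ≤ v → v + 2 ≤ w → w < hi → Iso A v → Iso A w →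
    ∃ p ∈ A, (p.1 < v ∧ v < p.2 ∧ p.2 < w) ∨ (v < p.1 ∧ p.1 < w ∧ w < p.2)

def Cov (lo hi : ℕ) (A : Finset (ℕ × ℕ)) : Prop :=
  ∀ v, lo ≤ v → v < hi → Iso A v → ∃ p ∈ A, p.1 < v ∧ v < p.2

def SatB (b : Bool) (lo hi : ℕ) (A : Finset (ℕ × ℕ)) : Prop :=
  Stk lo hi A ∧ Sat lo hi A ∧ (b = true → Cov lo hi A)

open Classical in
noncomputable def SF (b : Bool) (lo hi : ℕ) : Finset (Finset (ℕ × ℕ)) :=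
  (Finset.range hi ×ˢ Finset.range hi).powerset.filter (SatB b lo hi)

theorem mem_SF (b : Bool) (lo hi : ℕ) (A : Finset (ℕ × ℕ)) :
    A ∈ SF b lo hi ↔ SatB b lo hi A := by
  classical
  unfold SF
  rw [Finset.mem_filter, Finset.mem_powerset]
  constructor
  · exact fun h => h.2
  · intro h
    refine ⟨fun p hp => ?_, h⟩
    have := h.1.1 p hp
    simp only [Finset.mem_product, Finset.mem_range]
    omega

theorem saturated_iff (n : ℕ) (A : Finset (ℕ × ℕ)) :
    IsSaturatedStack n A ↔ SatB false 1 (n+1) A := by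
  have hst : ∀ A, IsStack n A ↔ Stk 1 (n+1) A := by
    intro A
    unfold IsStack Stk
    simp only [Nat.lt_succ_iff]
  unfold IsSaturatedStack SatB
  rw [hst]
  simp only [Bool.false_eq_true, false_imp_iff, and_true]
  refine and_congr_right fun hA => ?_
  constructor
  · intro h v w hv hw hn iv iw
    by_contra hc
    push Not at hc
    have hnot : (v, w) ∉ A := fun hm => (iv _ hm).1 rfl
    apply h (v, w) hnot
    rw [hst]
    obtain ⟨h1, h2, h3⟩ := hA
    refine ⟨?_, ?_, ?_⟩
    · intro p hp
      rcases Finset.mem_insert.1 hp with rfl | hp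
      · exact ⟨hv, hn, hw⟩
      · exact h1 p hp
    · intro p hp q hq hpq
      rcases Finset.mem_insert.1 hp with rfl | hp <;> rcases Finset.mem_insert.1 hq with rfl | hq
      · exact absurd rfl hpq
      · have := iv q hq; have := iw q hq; grind
      · have := iv p hp; have := iw p hp; grind
      · exact h2 p hp q hq hpq
    · intro p hp q hq
      rcases Finset.mem_insert.1 hp with rfl | hp <;> rcases Finset.mem_insert.1 hq with rfl | hq
      · simp
      · have := hc q hq; grind
      · have := hc p hp; grind
      · exact h3 p hp q hq
  · intro h p hp hs
    rw [hst] at hs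
    obtain ⟨h1, h2, h3⟩ := hs
    have hpm := Finset.mem_insert_self p A
    have hb := h1 p hpm
    have hne : ∀ q ∈ A, q ≠ p := fun q hq e => hp (e ▸ hq)
    have iso := fun q hq => h2 q (Finset.mem_insert_of_mem hq) p hpm (hne q hq)
    obtain ⟨q, hq, hc⟩ := h p.1 p.2 hb.1 hb.2.2 hb.2.1 (fun q hq => ⟨(iso q hq).1, (iso q hq).2.2.1⟩)
      (fun q hq => ⟨(iso q hq).2.1, (iso q hq).2.2.2⟩)
    have := h3 p hpm q (Finset.mem_insert_of_mem hq)
    have := h3 q (Finset.mem_insert_of_mem hq) p hpm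
    omega

theorem satB_nil (b : Bool) (lo : ℕ) (A : Finset (ℕ × ℕ)) : SatB b lo lo A ↔ A = ∅ := by
  constructor
  · intro h
    rw [Finset.eq_empty_iff_forall_notMem]
    intro p hp
    have := h.1.1 p hp
    omega
  · rintro rfl
    refine ⟨⟨by simp, by simp, by simp⟩, ?_, ?_⟩
    · intro v w; intros; omega
    · intro _ v; intros; omega

theorem satT_not_iso (lo hi : ℕ) (h : lo < hi) (A : Finset (ℕ × ℕ)) (hA : SatB true lo hi A) :
    ¬ Iso A lo := by
  intro hi'
  obtain ⟨p, hp, h1⟩ := hA.2.2 rfl lo le_rfl h hi'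
  have := hA.1.1 p hp
  omega

theorem not_iso (lo hi : ℕ) (A : Finset (ℕ × ℕ)) (hA : Stk lo hi A) (h : ¬ Iso A lo) :
    ∃ j, (lo, j) ∈ A ∧ lo + 2 ≤ j ∧ j < hi := by
  unfold Iso at h
  push Not at h
  obtain ⟨p, hp, h1⟩ := h
  have := hA.1 p hp
  have : p.1 = lo := by
    by_contra hne
    have := h1 hne
    omega
  refine ⟨p.2, ?_, ?_, ?_⟩
  · rw [← this]; exact hp
  · omega
  · omega

theorem iso_step (lo hi : ℕ) (h : lo < hi) (A : Finset (ℕ × ℕ)) :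
    (SatB false lo hi A ∧ Iso A lo) ↔
      (SatB true (lo+1) hi A ∨ (lo + 2 ≤ hi ∧ SatB true (lo+2) hi A)) := by
  constructor
  · rintro ⟨⟨⟨h1, h2, h3⟩, hs, -⟩, hiso⟩
    have hS1 : Stk (lo+1) hi A := by
      refine ⟨fun p hp => ?_, h2, h3⟩
      have := h1 p hp; have := hiso p hp; omega
    have hcov : ∀ v, lo + 2 ≤ v → v < hi → Iso A v → ∃ p ∈ A, p.1 < v ∧ v < p.2 := by
      intro v hv hv2 hv3
      obtain ⟨p, hp, hp2⟩ := hs lo v le_rfl hv hv2 hiso hv3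
      have := h1 p hp
      exact ⟨p, hp, by omega⟩
    by_cases hI : lo + 2 ≤ hi ∧ Iso A (lo+1)
    · right
      refine ⟨hI.1, ⟨fun p hp => ?_, h2, h3⟩, ?_, fun _ => hcov⟩
      · have := hS1.1 p hp; have := hI.2 p hp; omega
      · intro v w hv; exact hs v w (by omega)
    · left
      refine ⟨hS1, ?_, fun _ => ?_⟩
      · intro v w hv; exact hs v w (by omega)
      · intro v hv hv2 hv3
        rcases Nat.eq_or_lt_of_le hv with rfl | hv
        · exact absurd ⟨by omega, hv3⟩ hI
        · exact hcov v hv hv2 hv3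
  · have key : ∀ d, (∀ p ∈ A, lo + d + 1 ≤ p.1) → d ≤ 1 → SatB true (lo+d+1) hi A →
        (SatB false lo hi A ∧ Iso A lo) := by
      rintro d - hd ⟨⟨h1, h2, h3⟩, hs, hc⟩
      refine ⟨⟨⟨fun p hp => ?_, h2, h3⟩, ?_, by simp⟩, fun p hp => ?_⟩
      · have := h1 p hp; omega
      · intro v w hv hw hhi iv iw
        by_cases hvl : lo + d + 1 ≤ v
        · exact hs v w hvl hw hhi iv iw
        · obtain ⟨p, hp, hp2⟩ := hc rfl w (by omega) hhi iw
          have := h1 p hp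
          exact ⟨p, hp, by omega⟩
      · have := h1 p hp; omega
    rintro (h | ⟨_, h⟩)
    · exact key 0 (fun p hp => (h.1.1 p hp).1) (by omega) h
    · exact key 1 (fun p hp => (h.1.1 p hp).1) (by omega) h

/-- the inner part -/
def inn (lo j : ℕ) (A : Finset (ℕ × ℕ)) : Finset (ℕ × ℕ) := A.filter (fun p => lo < p.1 ∧ p.1 < j)
def out (j : ℕ) (A : Finset (ℕ × ℕ)) : Finset (ℕ × ℕ) := A.filter (fun p => j < p.1)

theorem split_mem {lo hi j : ℕ} {A : Finset (ℕ × ℕ)} (hA : Stk lo hi A) (hj : (lo, j) ∈ A)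
    (p : ℕ × ℕ) (hp : p ∈ A) : p = (lo, j) ∨ (lo < p.1 ∧ p.2 < j) ∨ (j < p.1) := by
  by_cases h : p = (lo, j)
  · exact Or.inl h
  · right
    have h1 := hA.1 p hp
    have h2 := hA.2.1 p hp _ hj h
    have h3 := hA.2.2 _ hj p hp
    have h4 := hA.1 _ hj
    simp only at h2 h3 h4
    omega

theorem split_eq {lo hi j : ℕ} {A : Finset (ℕ × ℕ)} (hA : Stk lo hi A) (hj : (lo, j) ∈ A) :
    insert (lo, j) (inn lo j A ∪ out j A) = A := by
  ext p
  simp only [Finset.mem_insert, Finset.mem_union, inn, out, Finset.mem_filter]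
  constructor
  · rintro (rfl | h | h)
    · exact hj
    · exact h.1
    · exact h.1
  · intro hp
    have h1 := hA.1 p hp
    rcases split_mem hA hj p hp with h | h | h
    · exact Or.inl h
    · exact Or.inr (Or.inl ⟨hp, by omega⟩)
    · exact Or.inr (Or.inr ⟨hp, by omega⟩)

theorem inn_join {lo hi j : ℕ} {B C : Finset (ℕ × ℕ)} (hB : Stk (lo+1) j B) (hC : Stk (j+1) hi C) :
    inn lo j (insert (lo, j) (B ∪ C)) = B := by
  ext p
  simp only [Finset.mem_insert, Finset.mem_union, inn, Finset.mem_filter]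
  constructor
  · rintro ⟨rfl | h | h, h2⟩
    · simp at h2
    · exact h
    · have := hC.1 p h; omega
  · intro h
    have := hB.1 p h
    exact ⟨Or.inr (Or.inl h), by omega⟩

theorem out_join {lo hi j : ℕ} {B C : Finset (ℕ × ℕ)} (hj : lo + 2 ≤ j)
    (hB : Stk (lo+1) j B) (hC : Stk (j+1) hi C) :
    out j (insert (lo, j) (B ∪ C)) = C := by
  ext p
  simp only [Finset.mem_insert, Finset.mem_union, out, Finset.mem_filter]
  constructor
  · rintro ⟨rfl | h | h, h2⟩
    · simp at h2; omega
    · have := hB.1 p h; omega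
    · exact h
  · intro h
    have := hC.1 p h
    exact ⟨Or.inr (Or.inr h), by omega⟩

theorem join_card {lo hi j : ℕ} {B C : Finset (ℕ × ℕ)}
    (hB : Stk (lo+1) j B) (hC : Stk (j+1) hi C) :
    (insert (lo, j) (B ∪ C)).card = 1 + B.card + C.card := by
  rw [Finset.card_insert_of_notMem, Finset.card_union_of_disjoint]
  · omega
  · rw [Finset.disjoint_left]
    intro p h1 h2
    have := hB.1 p h1; have := hC.1 p h2; omega
  · intro h
    rcases Finset.mem_union.1 h with h | h
    · have := hB.1 _ h; simp at this
    · have := hC.1 _ h; simp at this; omega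

theorem join_sat (b : Bool) {lo hi j : ℕ} {B C : Finset (ℕ × ℕ)} (hj : lo + 2 ≤ j) (hjh : j < hi)
    (hB : SatB false (lo+1) j B) (hC : SatB b (j+1) hi C) :
    SatB b lo hi (insert (lo, j) (B ∪ C)) := by
  obtain ⟨⟨b1, b2, b3⟩, bs, -⟩ := hB
  obtain ⟨⟨c1, c2, c3⟩, cs, cc⟩ := hC
  have hm : ∀ p, p ∈ insert (lo, j) (B ∪ C) ↔ p = (lo, j) ∨ p ∈ B ∨ p ∈ C := by simp
  have hIB : ∀ v, Iso (insert (lo, j) (B ∪ C)) v → Iso B v := fun v h p hp =>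
    h p ((hm p).2 (Or.inr (Or.inl hp)))
  have hIC : ∀ v, Iso (insert (lo, j) (B ∪ C)) v → Iso C v := fun v h p hp =>
    h p ((hm p).2 (Or.inr (Or.inr hp)))
  have hIj : ∀ v, Iso (insert (lo, j) (B ∪ C)) v → lo ≠ v ∧ j ≠ v := fun v h =>
    h _ ((hm _).2 (Or.inl rfl))
  refine ⟨⟨?_, ?_, ?_⟩, ?_, ?_⟩
  · intro p hp
    rcases (hm p).1 hp with rfl | hp | hp
    · simp; omega
    · have := b1 p hp; omega
    · have := c1 p hp; omega
  · intro p hp q hq hpq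
    rcases (hm p).1 hp with rfl | hp | hp <;> rcases (hm q).1 hq with rfl | hq | hq
    · exact absurd rfl hpq
    · have := b1 q hq; simp only; omega
    · have := c1 q hq; simp only; omega
    · have := b1 p hp; simp only; omega
    · exact b2 p hp q hq hpq
    · have := b1 p hp; have := c1 q hq; omega
    · have := c1 p hp; simp only; omega
    · have := c1 p hp; have := b1 q hq; omega
    · exact c2 p hp q hq hpq
  · intro p hp q hq
    rcases (hm p).1 hp with rfl | hp | hp <;> rcases (hm q).1 hq with rfl | hq | hq
    · simp
    · have := b1 q hq; simp only; omega
    · have := c1 q hq; simp only; omega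
    · have := b1 p hp; simp only; omega
    · exact b3 p hp q hq
    · have := b1 p hp; have := c1 q hq; omega
    · have := c1 p hp; simp only; omega
    · have := c1 p hp; have := b1 q hq; omega
    · exact c3 p hp q hq
  · intro v w hv hw hhi iv iw
    have := hIj v iv
    have := hIj w iw
    by_cases hvj : v < j
    · by_cases hwj : w < j
      · obtain ⟨p, hp, h⟩ := bs v w (by omega) hw hwj (hIB v iv) (hIB w iw)
        exact ⟨p, (hm p).2 (Or.inr (Or.inl hp)), h⟩
      · exact ⟨(lo, j), (hm _).2 (Or.inl rfl), by simp only; omega⟩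
    · obtain ⟨p, hp, h⟩ := cs v w (by omega) hw hhi (hIC v iv) (hIC w iw)
      exact ⟨p, (hm p).2 (Or.inr (Or.inr hp)), h⟩
  · intro hb v hv hhi iv
    have := hIj v iv
    by_cases hvj : v < j
    · exact ⟨(lo, j), (hm _).2 (Or.inl rfl), by simp only; omega⟩
    · obtain ⟨p, hp, h⟩ := cc hb v (by omega) hhi (hIC v iv)
      exact ⟨p, (hm p).2 (Or.inr (Or.inr hp)), h⟩

theorem split_inn (b : Bool) {lo hi j : ℕ} {A : Finset (ℕ × ℕ)} (hA : SatB b lo hi A)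
    (hj : (lo, j) ∈ A) : SatB false (lo+1) j (inn lo j A) := by
  have hsp := split_mem hA.1 hj
  obtain ⟨⟨a1, a2, a3⟩, as, ac⟩ := hA
  have hjj := a1 _ hj
  simp only at hjj
  have hm : ∀ p, p ∈ inn lo j A ↔ p ∈ A ∧ (lo < p.1 ∧ p.1 < j) := by simp [inn]
  have hI : ∀ v, lo + 1 ≤ v → v < j → Iso (inn lo j A) v → Iso A v := by
    intro v hv hvj h p hp
    rcases hsp p hp with rfl | h' | h'
    · simp only; omega
    · have := a1 p hp
      exact h p ((hm p).2 ⟨hp, by omega⟩)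
    · have := a1 p hp; omega
  refine ⟨⟨?_, ?_, ?_⟩, ?_, by simp⟩
  · intro p hp
    have hp := (hm p).1 hp
    have := a1 p hp.1
    rcases hsp p hp.1 with rfl | h' | h'
    · simp at hp
    · omega
    · omega
  · exact fun p hp q hq => a2 p ((hm p).1 hp).1 q ((hm q).1 hq).1
  · exact fun p hp q hq => a3 p ((hm p).1 hp).1 q ((hm q).1 hq).1
  · intro v w hv hw hwj iv iw
    obtain ⟨p, hp, h⟩ := as v w (by omega) hw (by omega) (hI v hv (by omega) iv)
      (hI w (by omega) hwj iw)
    refine ⟨p, (hm p).2 ⟨hp, ?_⟩, h⟩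
    rcases hsp p hp with rfl | h' | h'
    · simp only at h ⊢; omega
    · have := a1 p hp; omega
    · have := a1 p hp; omega

theorem split_out (b : Bool) {lo hi j : ℕ} {A : Finset (ℕ × ℕ)} (hA : SatB b lo hi A)
    (hj : (lo, j) ∈ A) : SatB b (j+1) hi (out j A) := by
  have hsp := split_mem hA.1 hj
  obtain ⟨⟨a1, a2, a3⟩, as, ac⟩ := hA
  have hjj := a1 _ hj
  simp only at hjj
  have hm : ∀ p, p ∈ out j A ↔ p ∈ A ∧ (j < p.1) := by simp [out]
  have hI : ∀ v, j + 1 ≤ v → Iso (out j A) v → Iso A v := by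
    intro v hvj h p hp
    rcases hsp p hp with rfl | h' | h'
    · simp only; omega
    · have := a1 p hp
      omega
    · exact h p ((hm p).2 ⟨hp, by omega⟩)
  refine ⟨⟨?_, ?_, ?_⟩, ?_, ?_⟩
  · intro p hp
    have hp := (hm p).1 hp
    have := a1 p hp.1
    omega
  · exact fun p hp q hq => a2 p ((hm p).1 hp).1 q ((hm q).1 hq).1
  · exact fun p hp q hq => a3 p ((hm p).1 hp).1 q ((hm q).1 hq).1
  · intro v w hv hw hwj iv iw
    obtain ⟨p, hp, h⟩ := as v w (by omega) hw (by omega) (hI v hv iv)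
      (hI w (by omega) iw)
    refine ⟨p, (hm p).2 ⟨hp, ?_⟩, h⟩
    rcases hsp p hp with rfl | h' | h'
    · simp only at h ⊢; omega
    · have := a1 p hp; omega
    · omega
  · intro hb v hv hhi iv
    obtain ⟨p, hp, h⟩ := ac hb v (by omega) hhi (hI v hv iv)
    refine ⟨p, (hm p).2 ⟨hp, ?_⟩, h⟩
    rcases hsp p hp with rfl | h' | h'
    · simp only at h ⊢; omega
    · have := a1 p hp; omega
    · omega
open PowerSeries in
theorem coeff_pow_lt {R : Type*} [CommRing R] (V : PowerSeries R) (j n : ℕ) (h : n < j) :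
    coeff n ((X * V) ^ j) = 0 := by
  rw [mul_pow, coeff_X_pow_mul', if_neg (by omega)]

open PowerSeries in
theorem lagrange {R : Type*} [CommRing R] [IsDomain R] [CharZero R] (φ V : PowerSeries R)
    (h : V = φ.subst (X * V)) (k m : ℕ) (hmk : m ≤ k) :
    (k : R) * coeff k ((X * V) ^ m) = m * coeff (k - m) (φ ^ k) := by
  have hs : HasSubst (X * V) := HasSubst.of_constantCoeff_zero' (by simp)
  have hexp : ∀ m n, coeff n (V ^ m) =
      ∑ j ∈ Finset.range (n+1), coeff j (φ ^ m) * coeff n ((X * V) ^ j) := by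
    intro m n
    conv_lhs => rw [h, ← subst_pow hs, coeff_subst' hs]
    rw [finsum_eq_sum_of_support_subset (s := Finset.range (n+1))]
    · simp
    · intro j hj
      simp only [Finset.coe_range, Set.mem_Iio]
      by_contra hc
      apply hj
      simp only
      rw [coeff_pow_lt _ _ _ (by omega), smul_zero]
  induction k using Nat.strong_induction_on generalizing m with
  | _ k ih =>
  rcases Nat.eq_zero_or_pos m with rfl | hm
  · rcases Nat.eq_zero_or_pos k with rfl | hk
    · simp
    · simp [coeff_one, hk.ne']
  rcases Nat.eq_or_lt_of_le hmk with rfl | hlt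
  · have := hexp m 0
    simp only [zero_add, Finset.range_one, Finset.sum_singleton, pow_zero] at this
    rw [mul_pow, coeff_X_pow_mul', if_pos le_rfl, Nat.sub_self, this]
    simp
  · obtain ⟨d, rfl⟩ := Nat.exists_eq_add_of_lt hlt
    have hd : ((d + 1 : ℕ) : R) ≠ 0 := by exact_mod_cast Nat.succ_ne_zero d
    apply mul_left_cancel₀ hd
    have e1 : m + d + 1 - m = d + 1 := by omega
    rw [mul_pow, coeff_X_pow_mul', if_pos hmk, e1, hexp]
    have step : ((d+1 : ℕ) : R) * ∑ j ∈ Finset.range (d+1+1), coeff j (φ ^ m) * coeff (d+1) ((X * V) ^ j)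
        = coeff (d+1) (X * d⁄dX R (φ ^ m) * φ ^ (d+1)) := by
      rw [coeff_mul, Finset.Nat.sum_antidiagonal_eq_sum_range_succ_mk, Finset.mul_sum]
      refine Finset.sum_congr rfl fun j hj => ?_
      have := ih (d+1) (by omega) j (by simp at hj; omega)
      have e2 : coeff j (X * d⁄dX R (φ ^ m)) = j * coeff j (φ ^ m) := by
        cases j with
        | zero => simp
        | succ j => rw [mul_comm, coeff_succ_mul_X, coeff_derivative]; push_cast; ring
      rw [e2]
      linear_combination coeff j (φ ^ m) * this
    have alg : ((m + d + 1 : ℕ) : PowerSeries R) * (X * d⁄dX R (φ ^ m) * φ ^ (d+1)) =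
        (m : PowerSeries R) * (d⁄dX R (φ ^ (m+d+1)) * X) := by
      obtain ⟨m, rfl⟩ := Nat.exists_eq_succ_of_ne_zero hm.ne'
      simp only [Derivation.leibniz_pow, nsmul_eq_mul, smul_eq_mul, Nat.succ_eq_add_one, Nat.add_sub_cancel]
      push_cast; ring
    have alg2 := congrArg (coeff (d+1)) alg
    rw [← map_natCast (C (R := R)), coeff_C_mul, ← map_natCast (C (R := R)), coeff_C_mul, coeff_succ_mul_X, coeff_derivative] at alg2
    rw [← step] at alg2
    push_cast at alg2 ⊢
    linear_combination alg2

open PowerSeries in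
theorem phi_coeff {R : Type*} [CommRing R] (w : R) (k : ℕ) (φ : PowerSeries R)
    (hφ : φ = X * (invOneSubPow R 1).val + C w * (invOneSubPow R 2).val) :
    coeff k (φ ^ (k+1)) = ∑ t ∈ Finset.Icc 1 (k+1), ((k+1).choose t : R) * ((2*t+k-1).choose (t-1) : R) * w ^ t := by
  have hq : ∀ n, (invOneSubPow R n).val = (invOneSubPow R 1).val ^ n := by
    intro n
    rw [invOneSubPow_eq_inv_one_sub_pow, invOneSubPow_eq_inv_one_sub_pow]
    simp
  rw [hφ, add_comm, add_pow, map_sum, Finset.range_eq_Ico, Finset.sum_eq_sum_Ico_succ_bot (by omega)]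
  have h0 : coeff k ((C w * (invOneSubPow R 2).val) ^ 0 * (X * (invOneSubPow R 1).val) ^ (k+1-0) *
     (((k+1).choose 0 : ℕ) : PowerSeries R)) = 0 := by
    simp [mul_pow, coeff_X_pow_mul']
  rw [h0, zero_add]
  refine Finset.sum_congr (by ext; simp) fun t ht => ?_
  simp only [Finset.mem_Icc] at ht
  have : (C w * (invOneSubPow R 2).val) ^ t * (X * (invOneSubPow R 1).val) ^ (k+1-t) *
     (((k+1).choose t : ℕ) : PowerSeries R) = C (((k+1).choose t : R) * w ^ t) * (X ^ (k+1-t) * (invOneSubPow R (k+t+1)).val) := by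
    rw [hq 2, hq (k+t+1), mul_pow, mul_pow, ← pow_mul]
    have : k + t + 1 = 2 * t + (k+1-t) := by omega
    rw [this, pow_add]
    simp only [map_mul, map_pow, map_natCast]
    ring
  rw [this, coeff_C_mul, coeff_X_pow_mul', if_pos (by omega), invOneSubPow_val_succ_eq_mk_add_choose,
    coeff_mk]
  have e1 : k - (k+1-t) = t - 1 := by omega
  have e2 : k + t + (t-1) = 2*t+k-1 := by omega
  rw [e1, e2]
  have e3 : (2*t+k-1).choose (k+t) = (2*t+k-1).choose (t-1) := by
    rw [← Nat.choose_symm (by omega)]; congr 1; omega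
  rw [e3]; ring

open Polynomial in
noncomputable def PP (b : Bool) (lo hi : ℕ) : ℚ[X] := ∑ A ∈ SF b lo hi, (X : ℚ[X]) ^ A.card

noncomputable def PQ (lo hi : ℕ) : Polynomial ℚ := if lo = hi then 0 else PP false lo hi

theorem PP_nil (b : Bool) (lo : ℕ) : PP b lo lo = 1 := by
  have : SF b lo lo = {∅} := by
    ext A; rw [mem_SF, satB_nil, Finset.mem_singleton]
  rw [PP, this]; simp

open Classical in
theorem PP_arc (b : Bool) (lo hi j : ℕ) (hj : lo + 2 ≤ j) (hjh : j < hi) :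
    ∑ A ∈ SF b lo hi with (lo, j) ∈ A, (Polynomial.X : Polynomial ℚ) ^ A.card =
      Polynomial.X * (PP false (lo+1) j * PP b (j+1) hi) := by
  rw [PP, PP, Finset.sum_mul_sum, ← Finset.sum_product', Finset.mul_sum]
  refine Finset.sum_bij' (fun A _ => (inn lo j A, out j A))
    (fun BC _ => insert (lo, j) (BC.1 ∪ BC.2)) ?_ ?_ ?_ ?_ ?_
  · intro A hA
    simp only [Finset.mem_filter, mem_SF, Finset.mem_product] at hA ⊢
    exact ⟨split_inn b hA.1 hA.2, split_out b hA.1 hA.2⟩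
  · rintro ⟨B, C⟩ h
    simp only [Finset.mem_filter, mem_SF, Finset.mem_product] at h ⊢
    exact ⟨join_sat b hj hjh h.1 h.2, Finset.mem_insert_self _ _⟩
  · intro A hA
    simp only [Finset.mem_filter, mem_SF] at hA
    exact split_eq hA.1.1 hA.2
  · rintro ⟨B, C⟩ h
    simp only [mem_SF, Finset.mem_product] at h
    simp only [inn_join h.1.1 h.2.1, out_join hj h.1.1 h.2.1]
  · intro A hA
    simp only [Finset.mem_filter, mem_SF] at hA
    have := join_card (split_inn b hA.1 hA.2).1 (split_out b hA.1 hA.2).1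
    rw [split_eq hA.1.1 hA.2] at this
    rw [this]; ring

open Classical in
theorem PP_split (b : Bool) (lo hi : ℕ) :
    PP b lo hi = ∑ A ∈ SF b lo hi with Iso A lo, (Polynomial.X : Polynomial ℚ) ^ A.card +
      ∑ j ∈ Finset.Ico (lo+2) hi, Polynomial.X * (PP false (lo+1) j * PP b (j+1) hi) := by
  rw [PP, ← Finset.sum_filter_add_sum_filter_not (SF b lo hi) (fun A => Iso A lo)]
  congr 1
  have : ∀ j ∈ Finset.Ico (lo+2) hi, Polynomial.X * (PP false (lo+1) j * PP b (j+1) hi) =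
      ∑ A ∈ SF b lo hi with (lo, j) ∈ A, (Polynomial.X : Polynomial ℚ) ^ A.card := by
    intro j hj
    rw [Finset.mem_Ico] at hj
    rw [PP_arc b lo hi j hj.1 hj.2]
  rw [Finset.sum_congr rfl this, ← Finset.sum_biUnion]
  · refine Finset.sum_congr ?_ fun _ _ => rfl
    ext A
    simp only [Finset.mem_filter, Finset.mem_biUnion, mem_SF, Finset.mem_Ico]
    constructor
    · rintro ⟨h1, h2⟩
      obtain ⟨j, hj, hj2⟩ := not_iso lo hi A h1.1 h2
      exact ⟨j, hj2, h1, hj⟩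
    · rintro ⟨j, hj, h1, h2⟩
      exact ⟨h1, fun h => (h _ h2).1 rfl⟩
  · intro i hi' j hj hij
    rw [Function.onFun, Finset.disjoint_left]
    intro A h1 h2
    simp only [Finset.mem_filter, mem_SF] at h1 h2
    have := (h1.1.1.2.1 _ h1.2 _ h2.2 (by simpa using hij)).1
    simp at this

theorem PP_arcsum (b : Bool) (lo n : ℕ) :
    ∑ j ∈ Finset.Ico (lo+2) (lo+n+2), Polynomial.X * (PP false (lo+1) j * PP b (j+1) (lo+n+2)) =
    Polynomial.X * ∑ i ∈ Finset.range (n+1), PQ (lo+1) (lo+1+i) * PP b (lo+2+i) (lo+2+i+(n-i)) := by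
  rw [Finset.sum_range_succ', Finset.sum_Ico_eq_sum_range, ← Finset.mul_sum]
  have h0 : PQ (lo+1) (lo+1+0) = 0 := by simp [PQ]
  have h1 : lo + n + 2 - (lo + 2) = n := by omega
  rw [h0, zero_mul, add_zero, h1]
  refine congrArg _ (Finset.sum_congr rfl fun i hi => ?_)
  simp only [Finset.mem_range] at hi
  rw [PQ, if_neg (by omega)]
  have h2 : lo + 1 + (i + 1) = lo + 2 + i := by omega
  have h3 : lo + 2 + (i + 1) + (n - (i + 1)) = lo + n + 2 := by omega
  rw [h2, h3, add_assoc (lo+2) i 1]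

theorem PP_true_one (lo : ℕ) : PP true lo (lo+1) = 0 := by
  classical
  rw [PP_split, Finset.Ico_eq_empty (by omega), Finset.sum_empty, add_zero]
  apply Finset.sum_eq_zero
  intro A hA
  simp only [Finset.mem_filter, mem_SF] at hA
  exact absurd hA.2 (satT_not_iso _ _ (by omega) _ hA.1)

theorem PP_true_rec (lo n : ℕ) : PP true lo (lo+n+2) =
    Polynomial.X * ∑ i ∈ Finset.range (n+1), PQ (lo+1) (lo+1+i) * PP true (lo+2+i) (lo+2+i+(n-i)) := by
  classical
  rw [PP_split, PP_arcsum, add_eq_right]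
  apply Finset.sum_eq_zero
  intro A hA
  simp only [Finset.mem_filter, mem_SF] at hA
  exact absurd hA.2 (satT_not_iso _ _ (by omega) _ hA.1)

theorem PP_false_one (lo : ℕ) : PP false lo (lo+1) = 1 := by
  classical
  rw [PP_split, Finset.Ico_eq_empty (by omega), Finset.sum_empty, add_zero, ← PP_nil true (lo+1), PP]
  refine Finset.sum_congr ?_ fun _ _ => rfl
  ext A
  simp only [Finset.mem_filter, mem_SF]
  rw [iso_step _ _ (by omega)]
  simp

theorem PP_false_rec (lo n : ℕ) : PP false lo (lo+n+2) =
    PP true (lo+1) (lo+1+(n+1)) + PP true (lo+2) (lo+2+n) +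
    Polynomial.X * ∑ i ∈ Finset.range (n+1), PQ (lo+1) (lo+1+i) * PP false (lo+2+i) (lo+2+i+(n-i)) := by
  classical
  rw [PP_split, PP_arcsum]
  congr 1
  have e1 : lo+1+(n+1) = lo+n+2 := by omega
  have e2 : lo+2+n = lo+n+2 := by omega
  rw [e1, e2, PP, PP, ← Finset.sum_union]
  · refine Finset.sum_congr ?_ fun _ _ => rfl
    ext A
    simp only [Finset.mem_filter, mem_SF, Finset.mem_union]
    rw [iso_step _ _ (by omega)]
    simp
  · rw [Finset.disjoint_left]
    intro A h1 h2
    rw [mem_SF] at h1 h2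
    apply satT_not_iso _ _ (by omega) _ h1
    intro p hp
    have := h2.1.1 p hp
    omega

theorem PP_shift (n : ℕ) : ∀ b lo, PP b lo (lo+n) = PP b 0 n := by
  induction n using Nat.strong_induction_on with
  | _ n ih =>
  have ihQ : ∀ i < n, ∀ lo, PQ lo (lo+i) = PQ 0 i := by
    intro i hi lo
    unfold PQ
    rw [ih i hi]
    by_cases h : i = 0 <;> simp [h, eq_comm]
  have hsum : ∀ m, m + 2 = n → ∀ b lo,
      ∑ i ∈ Finset.range (m+1), PQ (lo+1) (lo+1+i) * PP b (lo+2+i) (lo+2+i+(m-i)) =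
      ∑ i ∈ Finset.range (m+1), PQ 0 i * PP b 0 (m-i) := by
    intro m hm b lo
    refine Finset.sum_congr rfl fun i hi => ?_
    simp only [Finset.mem_range] at hi
    rw [ihQ i (by omega), ih (m-i) (by omega)]
  intro b lo
  match n, ih, ihQ, hsum with
  | 0, _, _, _ => rw [add_zero, PP_nil, PP_nil]
  | 1, _, _, _ =>
    have h0 := PP_true_one 0
    have h1 := PP_false_one 0
    rw [zero_add] at h0 h1
    cases b
    · rw [PP_false_one, h1]
    · rw [PP_true_one, h0]
  | m+2, ih, ihQ, hsum =>
    have h0 := PP_true_rec 0 m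
    have h1 := PP_false_rec 0 m
    rw [hsum m rfl] at h0 h1
    rw [ih _ (by omega), ih _ (by omega)] at h1
    rw [zero_add] at h0 h1
    cases b
    · rw [← add_assoc, PP_false_rec, h1, hsum m rfl, ih _ (by omega), ih _ (by omega)]
    · rw [← add_assoc, PP_true_rec, h0, hsum m rfl]

theorem PQ_shift (n lo : ℕ) : PQ lo (lo+n) = PQ 0 n := by
  unfold PQ
  rw [PP_shift]
  by_cases h : n = 0 <;> simp [h, eq_comm]

theorem t_rec (n : ℕ) : PP true 0 (n+2) =
    Polynomial.X * ∑ p ∈ Finset.HasAntidiagonal.antidiagonal n, PQ 0 p.1 * PP true 0 p.2 := by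
  rw [Finset.Nat.sum_antidiagonal_eq_sum_range_succ_mk]
  have := PP_true_rec 0 n
  simpa only [PQ_shift, PP_shift, zero_add] using this

theorem s_rec (n : ℕ) : PP false 0 (n+2) = PP true 0 (n+1) + PP true 0 n +
    Polynomial.X * ∑ p ∈ Finset.HasAntidiagonal.antidiagonal n, PQ 0 p.1 * PP false 0 p.2 := by
  rw [Finset.Nat.sum_antidiagonal_eq_sum_range_succ_mk]
  have := PP_false_rec 0 n
  simpa only [PQ_shift, PP_shift, zero_add] using this

/-- bivariate series -/
noncomputable def bis (f : ℕ → Polynomial ℚ) : PowerSeries (PowerSeries ℚ) :=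
  PowerSeries.mk fun k => PowerSeries.mk fun n => (f n).coeff k

open PowerSeries in
theorem bis_mul (f g h : ℕ → Polynomial ℚ) (h0 : h 0 = 0) (h1 : h 1 = 0)
    (h2 : ∀ n, h (n+2) = Polynomial.X * ∑ p ∈ Finset.HasAntidiagonal.antidiagonal n, f p.1 * g p.2) :
    bis h = X * (C (X ^ 2 : PowerSeries ℚ) * bis f) * bis g := by
  have : X * (C (X ^ 2 : PowerSeries ℚ) * bis f) * bis g = X * (C (X ^ 2 : PowerSeries ℚ) * (bis f * bis g)) := by ring
  rw [this]
  ext k n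
  simp only [bis, coeff_mk]
  match k with
  | 0 =>
    rw [coeff_zero_X_mul, map_zero]
    match n with
    | 0 => simp [h0]
    | 1 => simp [h1]
    | n+2 => simp [h2]
  | k+1 =>
    rw [coeff_succ_X_mul, coeff_C_mul, coeff_X_pow_mul']
    match n with
    | 0 => simp [h0]
    | 1 => simp [h1]
    | n+2 =>
      rw [if_pos (by omega), h2, Polynomial.coeff_X_mul, coeff_mul, map_sum, Polynomial.finsetSum_coeff]
      simp only [Polynomial.coeff_mul, coeff_mul, coeff_mk, Nat.add_sub_cancel]
      rw [Finset.sum_comm]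

theorem bis_add (f g : ℕ → Polynomial ℚ) : bis (fun n => f n + g n) = bis f + bis g := by
  ext k n
  simp [bis]

theorem bis_one : bis (fun n => if n = 0 then 1 else 0) = 1 := by
  ext k n
  simp only [bis, PowerSeries.coeff_mk, PowerSeries.coeff_one]
  by_cases hn : n = 0 <;> by_cases hk : k = 0 <;> simp [hn, hk, Polynomial.coeff_one, PowerSeries.coeff_one]

open PowerSeries in
theorem bis_w (f h : ℕ → Polynomial ℚ) (h0 : h 0 = 0) (h1 : h 1 = f 0)
    (h2 : ∀ n, h (n+2) = f (n+1) + f n) :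
    bis h = C (X + X ^ 2 : PowerSeries ℚ) * bis f := by
  ext k n
  rw [coeff_C_mul, add_mul, map_add, coeff_X_pow_mul']
  simp only [bis, coeff_mk]
  match n with
  | 0 => simp [h0]
  | 1 => rw [← zero_add 1, coeff_succ_X_mul]; simp [h1]
  | n+2 => rw [coeff_succ_X_mul]; simp [h2]

open PowerSeries in
theorem bisT : bis (PP true 0) = 1 + X * (C (X ^ 2 : PowerSeries ℚ) * bis (PQ 0)) * bis (PP true 0) := by
  rw [← bis_mul (PQ 0) (PP true 0) (fun n => if n = 0 then 0 else PP true 0 n) (by simp)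
    (by simpa using PP_true_one 0) (fun n => by simp [t_rec]), ← bis_one, ← bis_add]
  congr 1
  ext1 n
  by_cases h : n = 0
  · simp [h, PP_nil]
  · simp [h]

open PowerSeries in
theorem bisS : bis (PP false 0) = 1 + C (X + X ^ 2 : PowerSeries ℚ) * bis (PP true 0) +
    X * (C (X ^ 2 : PowerSeries ℚ) * bis (PQ 0)) * bis (PP false 0) := by
  rw [← bis_mul (PQ 0) (PP false 0) (fun n => if n < 2 then 0 else PP false 0 n - (PP true 0 (n-1) + PP true 0 (n-2))) (by simp)
    (by simp) (fun n => by simp [s_rec]), ← bis_w (PP true 0) (fun n => if n = 0 then 0 else if n = 1 then PP true 0 0 else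
      PP true 0 (n-1) + PP true 0 (n-2)) (by simp) (by simp) (fun n => by simp), ← bis_one, ← bis_add, ← bis_add]
  congr 1
  ext1 n
  match n with
  | 0 => simp [PP_nil]
  | 1 => simpa [PP_nil] using PP_false_one 0
  | n+2 => simp

theorem bisQ : bis (PP false 0) = 1 + bis (PQ 0) := by
  rw [← bis_one, ← bis_add]
  congr 1
  ext1 n
  by_cases h : n = 0
  · simp [h, PQ, PP_nil]
  · simp [h, PQ, Ne.symm h]

open PowerSeries in
theorem Q_formula (k : ℕ) : (k + 1 : PowerSeries ℚ) * coeff k (bis (PQ 0)) =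
    X ^ (2 * k) * ∑ t ∈ Finset.Icc 1 (k+1), ((k+1).choose t : PowerSeries ℚ) *
      ((2*t+k-1).choose (t-1) : PowerSeries ℚ) * (X + X ^ 2) ^ t := by
  set w : PowerSeries ℚ := X + X ^ 2 with hw
  set x2 : PowerSeries ℚ := X ^ 2 with hx2
  set F := bis (PQ 0) with hF
  set T := bis (PP true 0) with hT
  set S := bis (PP false 0) with hS
  obtain ⟨φ, hφ⟩ : ∃ φ, φ = X * (invOneSubPow (PowerSeries ℚ) 1).val + C w * (invOneSubPow (PowerSeries ℚ) 2).val := ⟨_, rfl⟩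
  have e1 : T = 1 + X * (C x2 * F) * T := bisT
  have e2 : S = 1 + C w * T + X * (C x2 * F) * S := bisS
  have e3 : S = 1 + F := bisQ
  set U := X * (C x2 * F) with hU
  have hs : HasSubst U := HasSubst.of_constantCoeff_zero' (by simp [hU])
  have e4 : T * (1 - U) = 1 := by linear_combination e1
  have e5 : F = U * T + C w * T ^ 2 := by
    have : S = T + C w * T^2 := by
      linear_combination T * e2 - S * e4
    linear_combination this - e3 + e1
  set L := substAlgHom (R := PowerSeries ℚ) hs with hL
  have LX : L X = U := substAlgHom_X hs
  have LC : ∀ r : PowerSeries ℚ, L (C r) = C r := fun r => by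
    rw [hL, coe_substAlgHom hs]
    exact subst_C r
  have Lq : L (invOneSubPow (PowerSeries ℚ) 1).val = T := by
    have h1 : (invOneSubPow (PowerSeries ℚ) 1).val * (1 - X) = 1 := by
      have := (invOneSubPow (PowerSeries ℚ) 1).val_inv
      rwa [invOneSubPow_inv_eq_one_sub_pow, pow_one] at this
    have h2 := congrArg L h1
    rw [map_mul, map_sub, map_one, LX] at h2
    linear_combination (-L (invOneSubPow (PowerSeries ℚ) 1).val) * e4 + T * h2
  have Lq2 : L (invOneSubPow (PowerSeries ℚ) 2).val = T ^ 2 := by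
    have : (invOneSubPow (PowerSeries ℚ) 2).val = (invOneSubPow (PowerSeries ℚ) 1).val ^ 2 := by
      rw [invOneSubPow_eq_inv_one_sub_pow, invOneSubPow_eq_inv_one_sub_pow]
      simp
    rw [this, map_pow, Lq]
  have hsub : C x2 * F = (C x2 * φ).subst U := by
    rw [← coe_substAlgHom hs, ← hL, map_mul, LC, hφ, map_add, map_mul, map_mul, LX, LC, Lq, Lq2, ← e5]
  have : CharZero (PowerSeries ℚ) :=
    charZero_of_injective_ringHom (f := C (R := ℚ)) C_injective
  have main := lagrange (C x2 * φ) (C x2 * F) hsub (k+1) 1 (by omega)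
  rw [pow_one, coeff_succ_X_mul, coeff_C_mul, Nat.add_sub_cancel, mul_pow, ← map_pow, coeff_C_mul,
    phi_coeff w k φ hφ] at main
  have hx : x2 ≠ 0 := pow_ne_zero _ X_ne_zero
  apply mul_left_cancel₀ hx
  push_cast at main
  rw [pow_mul, ← hx2]
  linear_combination main

open PowerSeries in
theorem coeff_w (n k t : ℕ) : coeff n ((X : PowerSeries ℚ) ^ (2*k) * (X + X ^ 2) ^ t) =
    (chooseZ t ((n : ℤ) - 2 * k - t) : ℚ) := by
  have : (X : PowerSeries ℚ) ^ (2*k) * (X + X ^ 2) ^ t = X ^ (2*k+t) * (((1 + Polynomial.X) ^ t : Polynomial ℚ) : PowerSeries ℚ) := by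
    have : (X + X^2 : PowerSeries ℚ) = X * (1 + X) := by ring
    rw [this, mul_pow]
    simp; ring
  rw [this, coeff_X_pow_mul', chooseZ]
  by_cases h : 2 * k + t ≤ n
  · rw [if_pos h, if_pos (by omega), Polynomial.coeff_coe, Polynomial.coeff_one_add_X_pow]
    congr 2; omega
  · rw [if_neg h, if_neg (by omega)]; simp

theorem card_eq (n k : ℕ) (hn : 1 ≤ n) :
    (Nat.card {A : Finset (ℕ × ℕ) // IsSaturatedStack n A ∧ A.card = k} : ℚ) =
      PowerSeries.coeff n (PowerSeries.coeff k (bis (PQ 0))) := by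
  classical
  have h1 : Nat.card {A : Finset (ℕ × ℕ) // IsSaturatedStack n A ∧ A.card = k} =
      ((SF false 1 (1+n)).filter (fun A => A.card = k)).card := by
    rw [← Nat.card_eq_finsetCard]
    refine Nat.card_congr (Equiv.subtypeEquivRight fun A => ?_)
    rw [Finset.mem_filter, mem_SF, saturated_iff, add_comm]
  have h2 : PQ 0 n = PP false 1 (1+n) := by
    rw [PP_shift, PQ, if_neg (by omega)]
  rw [h1, bis, PowerSeries.coeff_mk, PowerSeries.coeff_mk, h2, PP, Polynomial.finsetSum_coeff]
  simp only [Polynomial.coeff_X_pow, Finset.card_filter, eq_comm]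
  push_cast
  rfl

theorem stmt9 (n k : ℕ) (hn : 1 ≤ n) :
    (Nat.card {A : Finset (ℕ × ℕ) // IsSaturatedStack n A ∧ A.card = k} : ℚ) =
      (1 / (k + 1 : ℚ)) * ∑ t ∈ Finset.Icc 1 (k + 1),
        (((k + 1).choose t : ℚ) * ((2 * t + k - 1).choose (t - 1) : ℚ) *
          (chooseZ t ((n : ℤ) - 2 * k - t) : ℚ)) := by
  rw [card_eq n k hn]
  have h := congrArg (PowerSeries.coeff n) (Q_formula k)
  have e : (k + 1 : PowerSeries ℚ) = PowerSeries.C (k + 1 : ℚ) := by simp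
  rw [e, PowerSeries.coeff_C_mul, Finset.mul_sum, map_sum] at h
  have hk : (k + 1 : ℚ) ≠ 0 := by positivity
  rw [one_div, eq_inv_mul_iff_mul_eq₀ hk, h]
  refine Finset.sum_congr rfl fun t _ => ?_
  rw [← coeff_w, mul_left_comm, ← PowerSeries.coeff_C_mul]
  simp
end

section
/- Let ELO_0(n) denote the number of extended 2-regular simple stacks on [n] with the maximum possible number floor(n/2) of arcs. For n ≥ 5: if n is even, ELO_0(n) = n - 3; if n is odd, ELO_0(n) = (n^3 - 3n^2 - 7n + 69)/12. -/
/-- The degree of vertex `v` in the arc set `A`. -/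
def arcDegree (A : Finset (ℕ × ℕ)) (v : ℕ) : ℕ :=
  (A.filter (fun p => p.1 = v ∨ p.2 = v)).card

/-- An extended 2-regular simple stack on `[n]`: arcs `(i,j)` with `1 ≤ i`, `j ≤ n`,
`j - i ≥ 2`, noncrossing, each internal vertex `2,…,n-1` of degree at most 1, and the
terminal vertices `1` and `n` of degree at most 2. -/
def IsExtStack (n : ℕ) (A : Finset (ℕ × ℕ)) : Prop :=
  (∀ p ∈ A, 1 ≤ p.1 ∧ p.2 ≤ n ∧ p.1 + 2 ≤ p.2) ∧
  (∀ p ∈ A, ∀ q ∈ A, ¬(p.1 < q.1 ∧ q.1 < p.2 ∧ p.2 < q.2)) ∧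
  (∀ v : ℕ, 1 < v → v < n → arcDegree A v ≤ 1) ∧
  arcDegree A 1 ≤ 2 ∧ arcDegree A n ≤ 2

/-- The number of extended 2-regular simple stacks on `[n]` with the maximum possible
number `⌊n/2⌋` of arcs. -/
noncomputable def ELO0 (n : ℕ) : ℕ :=
  Nat.card {A : Finset (ℕ × ℕ) // IsExtStack n A ∧ A.card = n / 2}


namespace ELO

open Finset

def Stk (c : ℕ → ℕ) (a b : ℕ) (A : Finset (ℕ × ℕ)) : Prop :=
  (∀ p ∈ A, a ≤ p.1 ∧ p.2 < b ∧ p.1 + 2 ≤ p.2) ∧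
  (∀ p ∈ A, ∀ q ∈ A, ¬(p.1 < q.1 ∧ q.1 < p.2 ∧ p.2 < q.2)) ∧
  (∀ v : ℕ, arcDegree A v ≤ c v)

lemma deg_mono {A B : Finset (ℕ × ℕ)} (h : A ⊆ B) (v : ℕ) : arcDegree A v ≤ arcDegree B v :=
  card_le_card (filter_subset_filter _ h)

lemma deg_union (A B : Finset (ℕ × ℕ)) (v : ℕ) :
    arcDegree (A ∪ B) v ≤ arcDegree A v + arcDegree B v := by
  unfold arcDegree
  rw [filter_union]
  exact card_union_le _ _

lemma deg_insert (A : Finset (ℕ × ℕ)) (a k v : ℕ) (h : (a, k) ∉ A) :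
    arcDegree (insert (a, k) A) v = arcDegree A v + (if a = v ∨ k = v then 1 else 0) := by
  unfold arcDegree
  rw [filter_insert]
  split_ifs with h1
  · rw [card_insert_of_notMem (by simp [h])]
  · rfl

lemma deg_zero (A : Finset (ℕ × ℕ)) (v : ℕ) (h : ∀ p ∈ A, p.1 ≠ v ∧ p.2 ≠ v) :
    arcDegree A v = 0 := by
  unfold arcDegree
  rw [card_eq_zero, filter_eq_empty_iff]
  intro p hp
  have := h p hp
  tauto

lemma deg_one {A : Finset (ℕ × ℕ)} {v : ℕ} (h : arcDegree A v ≤ 1) {p q : ℕ × ℕ}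
    (hp : p ∈ A) (hq : q ∈ A) (hpv : p.1 = v ∨ p.2 = v) (hqv : q.1 = v ∨ q.2 = v) : p = q := by
  unfold arcDegree at h
  rw [card_le_one] at h
  exact h p (by simp [hp, hpv]) q (by simp [hq, hqv])

lemma deg_pos {A : Finset (ℕ × ℕ)} {v : ℕ} (h : arcDegree A v = 0) {p : ℕ × ℕ}
    (hp : p ∈ A) : p.1 ≠ v ∧ p.2 ≠ v := by
  unfold arcDegree at h
  rw [card_eq_zero, filter_eq_empty_iff] at h
  have := h hp
  tauto

lemma Stk.congr {c c' : ℕ → ℕ} {a b : ℕ} {A : Finset (ℕ × ℕ)} (h : Stk c a b A)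
    (hc : ∀ v, a ≤ v → v < b → c v ≤ c' v) : Stk c' a b A := by
  refine ⟨h.1, h.2.1, fun v => ?_⟩
  by_cases hv : a ≤ v ∧ v < b
  · exact (h.2.2 v).trans (hc v hv.1 hv.2)
  · rw [deg_zero]
    · exact Nat.zero_le _
    · intro p hp
      have := h.1 p hp
      omega

lemma Stk.up {c : ℕ → ℕ} {a b : ℕ} {A : Finset (ℕ × ℕ)} (h : Stk c (a+1) b A) : Stk c a b A :=
  ⟨fun p hp => by have := h.1 p hp; omega, h.2⟩

lemma Stk.down {c : ℕ → ℕ} {a b : ℕ} {A : Finset (ℕ × ℕ)} (h : Stk c a b A)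
    (h0 : ∀ k, (a, k) ∉ A) : Stk c (a+1) b A := by
  refine ⟨fun p hp => ?_, h.2⟩
  have := h.1 p hp
  have h1 : p.1 ≠ a := by
    rintro rfl
    exact h0 p.2 hp
  omega

lemma Stk.subset {c : ℕ → ℕ} {a b : ℕ} {A B : Finset (ℕ × ℕ)} (h : Stk c a b A)
    (hB : B ⊆ A) : Stk c a b B :=
  ⟨fun p hp => h.1 p (hB hp), fun p hp q hq => h.2.1 p (hB hp) q (hB hq),
    fun v => (deg_mono hB v).trans (h.2.2 v)⟩

def decr (c : ℕ → ℕ) (a : ℕ) : ℕ → ℕ := fun v => if v = a then c v - 1 else c v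

def TopArc (a k : ℕ) (A : Finset (ℕ × ℕ)) : Prop := (a, k) ∈ A ∧ ∀ j, (a, j) ∈ A → j ≤ k

def glue (a k : ℕ) (B C : Finset (ℕ × ℕ)) : Finset (ℕ × ℕ) := insert (a, k) (B ∪ C)

def inn (k : ℕ) (A : Finset (ℕ × ℕ)) : Finset (ℕ × ℕ) := A.filter (fun p => p.2 < k)
def out (k : ℕ) (A : Finset (ℕ × ℕ)) : Finset (ℕ × ℕ) := A.filter (fun p => k < p.1)

lemma Stk.inn_out {c : ℕ → ℕ} {a b k : ℕ} {A : Finset (ℕ × ℕ)} (h : Stk c a b A)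
    (ht : TopArc a k A) (hk : c k = 1) : A = glue a k (inn k A) (out k A) := by
  ext p
  simp only [glue, inn, out, mem_insert, mem_union, mem_filter]
  constructor
  · intro hp
    by_cases e : p = (a, k)
    · exact Or.inl e
    right
    have d1 := h.2.2 k
    rw [hk] at d1
    have n1 : ¬ (p.1 = k ∨ p.2 = k) := fun hh => e (deg_one d1 hp ht.1 hh (Or.inr rfl))
    have n2 := h.2.1 _ ht.1 p hp
    have n3 : p.1 = a → p.2 ≤ k := by
      rintro rfl
      exact ht.2 _ hp
    have n4 := h.1 p hp
    simp only [hp, true_and]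
    simp only at n2
    omega
  · rintro (rfl | h | h)
    · exact ht.1
    · exact h.1
    · exact h.1

lemma Stk.inn {c : ℕ → ℕ} {a b k : ℕ} {A : Finset (ℕ × ℕ)} (h : Stk c a b A)
    (ht : TopArc a k A) : Stk (decr c a) a k (inn k A) := by
  have hs := h.subset (filter_subset (fun p : ℕ × ℕ => p.2 < k) A)
  refine ⟨fun p hp => ?_, hs.2.1, fun v => ?_⟩
  · have := hs.1 p hp
    have h2 := (mem_filter.1 hp).2
    omega
  · unfold decr
    split_ifs with hv
    · subst hv
      have hn : (v, k) ∉ ELO.inn k A := by simp [ELO.inn]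
      have h1 := deg_insert _ v k v hn
      have h2 : insert (v, k) (ELO.inn k A) ⊆ A := by
        intro p hp
        rcases mem_insert.1 hp with rfl | hp
        · exact ht.1
        · exact (mem_filter.1 hp).1
      have h3 := deg_mono h2 v
      have h4 := h.2.2 v
      simp at h1
      omega
    · exact hs.2.2 v

lemma Stk.out {c : ℕ → ℕ} {a b k : ℕ} {A : Finset (ℕ × ℕ)} (h : Stk c a b A) :
    Stk c (k+1) b (out k A) := by
  have hs := h.subset (filter_subset (fun p : ℕ × ℕ => k < p.1) A)
  refine ⟨fun p hp => ?_, hs.2⟩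
  have := hs.1 p hp
  have h2 := (mem_filter.1 hp).2
  omega

lemma Stk.glue {c : ℕ → ℕ} {a b k : ℕ} {B C : Finset (ℕ × ℕ)} (hB : Stk (decr c a) a k B)
    (hC : Stk c (k+1) b C) (hak : a + 2 ≤ k) (hkb : k < b) (ha : 1 ≤ c a) (hk : 1 ≤ c k) :
    Stk c a b (glue a k B C) := by
  have hn : (a, k) ∉ B ∪ C := by
    rw [mem_union]
    rintro (h | h)
    · have := hB.1 _ h
      simp at this
    · have := hC.1 _ h
      simp at this
      omega
  refine ⟨?_, ?_, ?_⟩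
  · intro p hp
    simp only [ELO.glue, mem_insert, mem_union] at hp
    rcases hp with rfl | hp | hp
    · simp; omega
    · have := hB.1 _ hp
      omega
    · have := hC.1 _ hp
      omega
  · intro p hp q hq
    simp only [ELO.glue, mem_insert, mem_union] at hp hq
    rcases hp with rfl | hp | hp <;> rcases hq with rfl | hq | hq
    · simp
    · have := hB.1 _ hq
      simp only; omega
    · have := hC.1 _ hq
      simp only; omega
    · have := hB.1 _ hp
      simp only; omega
    · exact hB.2.1 p hp q hq
    · have := hB.1 _ hp
      have := hC.1 _ hq
      omega
    · have := hC.1 _ hp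
      simp only; omega
    · have := hC.1 _ hp
      have := hB.1 _ hq
      omega
    · exact hC.2.1 p hp q hq
  · intro v
    unfold ELO.glue
    rw [deg_insert _ _ _ _ hn]
    have h1 := deg_union B C v
    have h2 := hB.2.2 v
    have h3 := hC.2.2 v
    have zB : k ≤ v → arcDegree B v = 0 := fun hv => deg_zero _ _ fun p hp => by
      have := hB.1 _ hp
      omega
    have zC : v ≤ k → arcDegree C v = 0 := fun hv => deg_zero _ _ fun p hp => by
      have := hC.1 _ hp
      omega
    unfold decr at h2
    rcases lt_trichotomy v k with hv | rfl | hv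
    · have := zC hv.le
      have : k ≠ v := by omega
      split_ifs at h2 ⊢ with e1 e2
      all_goals first
        | omega
        | (subst e2; omega)
    · have := zC le_rfl
      have := zB le_rfl
      split_ifs <;> omega
    · have := zB hv.le
      rw [if_neg (by omega)]
      omega

lemma inn_glue {c c' : ℕ → ℕ} {a b k : ℕ} {B C : Finset (ℕ × ℕ)} (hB : Stk c' a k B)
    (hC : Stk c (k+1) b C) : inn k (glue a k B C) = B := by
  ext p
  simp only [glue, inn, mem_insert, mem_union, mem_filter]
  constructor
  · rintro ⟨rfl | h | h, h2⟩
    · simp at h2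
    · exact h
    · have := hC.1 _ h
      omega
  · intro h
    have := hB.1 _ h
    exact ⟨Or.inr (Or.inl h), this.2.1⟩

lemma out_glue {c c' : ℕ → ℕ} {a b k : ℕ} {B C : Finset (ℕ × ℕ)} (hB : Stk c' a k B)
    (hC : Stk c (k+1) b C) (hak : a ≤ k) : out k (glue a k B C) = C := by
  ext p
  simp only [glue, out, mem_insert, mem_union, mem_filter]
  constructor
  · rintro ⟨rfl | h | h, h2⟩
    · simp at h2
      omega
    · have := hB.1 _ h
      omega
    · exact h
  · intro h
    have := hC.1 _ h
    exact ⟨Or.inr (Or.inr h), by omega⟩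

lemma top_glue {c c' : ℕ → ℕ} {a b k : ℕ} {B C : Finset (ℕ × ℕ)} (hB : Stk c' a k B)
    (hC : Stk c (k+1) b C) (hak : a ≤ k) : TopArc a k (glue a k B C) := by
  refine ⟨mem_insert_self _ _, fun j hj => ?_⟩
  simp only [glue, mem_insert, mem_union, Prod.mk.injEq, true_and] at hj
  rcases hj with rfl | h | h
  · rfl
  · have := hB.1 _ h
    simp at this
    omega
  · have := hC.1 _ h
    simp at this
    omega

lemma card_glue {c c' : ℕ → ℕ} {a b k : ℕ} {B C : Finset (ℕ × ℕ)} (hB : Stk c' a k B)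
    (hC : Stk c (k+1) b C) (hak : a ≤ k) : (glue a k B C).card = B.card + C.card + 1 := by
  unfold glue
  rw [card_insert_of_notMem, card_union_of_disjoint]
  · rw [Finset.disjoint_left]
    intro p h1 h2
    have := hB.1 _ h1
    have := hC.1 _ h2
    omega
  · rw [mem_union]
    rintro (h | h)
    · have := hB.1 _ h
      simp at this
    · have := hC.1 _ h
      simp at this
      omega

lemma exists_top {c : ℕ → ℕ} {a b : ℕ} {A : Finset (ℕ × ℕ)} (h : Stk c a b A)
    (h0 : ¬ ∀ k, (a, k) ∉ A) : ∃ k, a + 2 ≤ k ∧ k < b ∧ TopArc a k A := by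
  push Not at h0
  obtain ⟨k0, hk0⟩ := h0
  have hne : (A.filter (fun p => p.1 = a)).Nonempty := ⟨(a, k0), by simp [hk0]⟩
  obtain ⟨p, hp, hm⟩ := exists_max_image _ Prod.snd hne
  rw [mem_filter] at hp
  have e : p = (a, p.2) := by rw [← hp.2]
  have := h.1 p hp.1
  refine ⟨p.2, by omega, by omega, ?_, ?_⟩
  · rw [← e]; exact hp.1
  · intro j hj
    exact hm (a, j) (by simp [hj])

lemma topArc_unique {a k l : ℕ} {A : Finset (ℕ × ℕ)} (h : TopArc a k A) (h' : TopArc a l A) : k = l :=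
  le_antisymm (h'.2 _ h.1) (h.2 _ h'.1)

/-- bound for ordinary stacks -/
lemma bound1 (L : ℕ) : ∀ (a b : ℕ) (A : Finset (ℕ × ℕ)), b = a + L → Stk (fun _ => 1) a b A →
    (L = 0 → A.card = 0) ∧ (1 ≤ L → 2 * A.card + 1 ≤ L) := by
  induction L using Nat.strong_induction_on with
  | _ L ih =>
    intro a b A hb hA
    by_cases h0 : ∀ k, (a, k) ∉ A
    · rcases Nat.eq_zero_or_pos L with rfl | hL
      · have : A = ∅ := eq_empty_of_forall_notMem fun p hp => by
          have := hA.1 p hp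
          omega
        subst this; simp
      · have := ih (L-1) (by omega) (a+1) b A (by omega) (hA.down h0)
        omega
    · obtain ⟨k, hk, hkb, ht⟩ := exists_top hA h0
      have hg := hA.inn_out ht rfl
      have hi := hA.inn ht
      have ho := hA.out (k := k)
      have hc := card_glue hi ho (by omega)
      rw [← hg] at hc
      have hi2 : Stk (fun _ => 1) (a+1) k (inn k A) := by
        have : ∀ j, (a, j) ∉ inn k A := fun j hj => by
          have h3 := hi.2.2 a
          simp [decr] at h3
          exact (deg_pos h3 hj).1 rfl
        exact (hi.down this).congr (fun v h1 h2 => by simp only [decr]; split_ifs <;> omega)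
      have h1 := ih (k-a-1) (by omega) (a+1) k _ (by omega) hi2
      have h2 := ih (b-k-1) (by omega) (k+1) b _ (by omega) ho
      omega

lemma bound1' {a b : ℕ} {A : Finset (ℕ × ℕ)} (h : Stk (fun _ => 1) a b A) :
    2 * A.card ≤ b - a ∧ (a < b → 2 * A.card + 1 ≤ b - a) := by
  by_cases hab : a ≤ b
  · have := bound1 (b - a) a b A (by omega) h
    omega
  · have : A = ∅ := eq_empty_of_forall_notMem fun p hp => by
      have := h.1 p hp
      omega
    subst this; simp; omega

def cU (b : ℕ) : ℕ → ℕ := fun v => if v + 1 = b then 2 else 1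

noncomputable def F (c : ℕ → ℕ) (a b d : ℕ) : Finset (Finset (ℕ × ℕ)) :=
  open Classical in
  ((range b ×ˢ range b).powerset).filter (fun A => Stk c a b A ∧ 2 * A.card + d + a = b)

lemma mem_F {c : ℕ → ℕ} {a b d : ℕ} {A : Finset (ℕ × ℕ)} :
    A ∈ F c a b d ↔ Stk c a b A ∧ 2 * A.card + d + a = b := by
  classical
  unfold F
  rw [mem_filter, mem_powerset]
  refine ⟨fun h => h.2, fun h => ⟨fun p hp => ?_, h⟩⟩
  have := h.1.1 p hp
  simp
  omega

lemma F_congr {c c' : ℕ → ℕ} {a b d : ℕ} (h : ∀ v, a ≤ v → v < b → c v = c' v) :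
    F c a b d = F c' a b d := by
  ext A
  rw [mem_F, mem_F]
  exact ⟨fun H => ⟨H.1.congr fun v h1 h2 => (h v h1 h2).le, H.2⟩,
    fun H => ⟨H.1.congr fun v h1 h2 => (h v h1 h2).ge, H.2⟩⟩

open Classical in
/-- first decomposition -/
lemma F_fiber (c : ℕ → ℕ) (a b d : ℕ) :
    (F c a b d).card = ((F c a b d).filter (fun A => ∀ k, (a, k) ∉ A)).card +
      ∑ k ∈ Ico (a+2) b, ((F c a b d).filter (TopArc a k)).card := by
  rw [← card_biUnion, ← card_union_of_disjoint]
  · congr 1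
    ext A
    simp only [mem_union, mem_filter, mem_biUnion, mem_Ico]
    constructor
    · intro h
      by_cases h0 : ∀ k, (a, k) ∉ A
      · exact Or.inl ⟨h, h0⟩
      · obtain ⟨k, h1, h2, h3⟩ := exists_top (mem_F.1 h).1 h0
        exact Or.inr ⟨k, ⟨h1, h2⟩, h, h3⟩
    · rintro (h | ⟨k, _, h, _⟩)
      · exact h.1
      · exact h
  · rw [Finset.disjoint_left]
    intro A h1 h2
    simp only [mem_filter, mem_biUnion] at h1 h2
    obtain ⟨k, _, _, h3⟩ := h2
    exact h1.2 k h3.1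
  · intro k _ l _ hkl
    rw [Function.onFun, Finset.disjoint_left]
    intro A h1 h2
    exact hkl (topArc_unique (mem_filter.1 h1).2 (mem_filter.1 h2).2)

open Classical in
lemma F_noarc (c : ℕ → ℕ) (a b d : ℕ) :
    (F c a b (d+1)).filter (fun A => ∀ k, (a, k) ∉ A) = F c (a+1) b d := by
  ext A
  rw [mem_filter, mem_F, mem_F]
  constructor
  · rintro ⟨⟨h1, h2⟩, h3⟩
    exact ⟨h1.down h3, by omega⟩
  · rintro ⟨h1, h2⟩
    refine ⟨⟨h1.up, by omega⟩, fun k hk => ?_⟩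
    have := h1.1 _ hk
    simp at this

open Classical in
lemma F_noarc0 (c : ℕ → ℕ) (a b : ℕ) (hb : ∀ A, Stk c (a+1) b A → 2 * A.card ≤ b - (a+1))
    (hab : a < b) :
    (F c a b 0).filter (fun A => ∀ k, (a, k) ∉ A) = ∅ := by
  refine eq_empty_of_forall_notMem fun A hA => ?_
  rw [mem_filter, mem_F] at hA
  have := hb A (hA.1.1.down hA.2)
  omega

/-- reduce zero capacity -/
lemma F_zero (c : ℕ → ℕ) (a b d : ℕ) (h : c a = 0) : F c a b (d+1) = F c (a+1) b d := by
  ext A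
  rw [mem_F, mem_F]
  constructor
  · rintro ⟨h1, h2⟩
    have h3 := h1.2.2 a
    rw [h] at h3
    exact ⟨h1.down fun k hk => (deg_pos (Nat.le_zero.1 h3) hk).1 rfl, by omega⟩
  · rintro ⟨h1, h2⟩
    exact ⟨h1.up, by omega⟩

open Classical in
lemma F_top (c : ℕ → ℕ) (a b d k : ℕ) (hak : a + 2 ≤ k) (hkb : k < b) (ha : 1 ≤ c a)
    (hk : c k = 1) (h1 : ∀ A, Stk (decr c a) a k A → 2 * A.card ≤ k - a)
    (h2 : ∀ A, Stk c (k+1) b A → 2 * A.card ≤ b - (k + 1)) :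
    ((F c a b d).filter (TopArc a k)).card =
      ∑ ij ∈ HasAntidiagonal.antidiagonal (d+1), (F (decr c a) a k ij.1).card * (F c (k+1) b ij.2).card := by
  simp_rw [← card_product]
  rw [← card_sigma]
  refine card_nbij'
    (fun A => ⟨(k - a - 2 * (inn k A).card, b - (k+1) - 2 * (out k A).card), (inn k A, out k A)⟩)
    (fun x => glue a k x.2.1 x.2.2) ?_ ?_ ?_ ?_
  · intro A hA
    rw [mem_coe, mem_filter, mem_F] at hA
    obtain ⟨⟨hS, hc⟩, ht⟩ := hA
    have hi := hS.inn ht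
    have ho := hS.out (k := k)
    have e := card_glue hi ho (by omega)
    rw [← hS.inn_out ht hk] at e
    have b1 := h1 _ hi
    have b2 := h2 _ ho
    simp only [mem_coe, mem_sigma, HasAntidiagonal.mem_antidiagonal, mem_product, mem_F]
    refine ⟨by omega, ⟨hi, by omega⟩, ⟨ho, by omega⟩⟩
  · rintro ⟨⟨i, j⟩, ⟨B, C⟩⟩ hx
    simp only [mem_coe, mem_sigma, HasAntidiagonal.mem_antidiagonal, mem_product, mem_F] at hx
    obtain ⟨hij, ⟨hB, hB2⟩, ⟨hC, hC2⟩⟩ := hx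
    simp only [mem_coe, mem_filter, mem_F]
    refine ⟨⟨hB.glue hC hak hkb ha hk.ge, ?_⟩, top_glue hB hC (by omega)⟩
    rw [card_glue hB hC (by omega)]
    omega
  · intro A hA
    rw [mem_coe, mem_filter, mem_F] at hA
    exact (hA.1.1.inn_out hA.2 hk).symm
  · rintro ⟨⟨i, j⟩, ⟨B, C⟩⟩ hx
    simp only [mem_coe, mem_sigma, HasAntidiagonal.mem_antidiagonal, mem_product, mem_F] at hx
    obtain ⟨hij, ⟨hB, hB2⟩, ⟨hC, hC2⟩⟩ := hx
    simp only [inn_glue hB hC, out_glue hB hC (show a ≤ k by omega)]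
    congr 2 <;> omega

lemma Stk.erase {c : ℕ → ℕ} {a b k : ℕ} {A : Finset (ℕ × ℕ)} (hS : Stk c a b A)
    (ht : (a, k) ∈ A) (hak : a ≠ k) : Stk (decr (decr c a) k) a b (A.erase (a, k)) := by
  have hs := hS.subset (erase_subset (a, k) A)
  refine ⟨hs.1, hs.2.1, fun v => ?_⟩
  have h1 := deg_insert (A.erase (a, k)) a k v (notMem_erase _ _)
  rw [insert_erase ht] at h1
  have h2 := hS.2.2 v
  unfold decr
  by_cases e1 : v = a <;> by_cases e2 : v = k
  · omega
  · subst e1; simp [e2] at h1 ⊢; omega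
  · subst e2; simp [e1] at h1 ⊢; omega
  · simp [e1, e2, Ne.symm e1, Ne.symm e2] at h1 ⊢; omega

open Classical in
lemma F_last (c : ℕ → ℕ) (a k d : ℕ) (hak : a + 2 ≤ k) (ha : 1 ≤ c a) (hk : 1 ≤ c k) :
    ((F c a (k+1) d).filter (TopArc a k)).card =
      ((F (decr (decr c a) k) a (k+1) (d+2)).filter (fun B => (a, k) ∉ B)).card := by
  refine card_nbij' (fun A => A.erase (a, k)) (fun B => insert (a, k) B) ?_ ?_ ?_ ?_
  · intro A hA
    rw [mem_coe, mem_filter, mem_F] at hA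
    obtain ⟨⟨hS, hc⟩, ht⟩ := hA
    rw [mem_coe, mem_filter, mem_F]
    have e := card_erase_add_one ht.1
    simp only
    exact ⟨⟨hS.erase ht.1 (by omega), by omega⟩, notMem_erase _ _⟩
  · intro B hB
    rw [mem_coe, mem_filter, mem_F] at hB
    obtain ⟨⟨hS, hc⟩, hn⟩ := hB
    rw [mem_coe, mem_filter, mem_F]
    refine ⟨⟨⟨?_, ?_, ?_⟩, ?_⟩, ?_, ?_⟩
    · intro p hp
      rcases mem_insert.1 hp with rfl | hp
      · simp; omega
      · exact hS.1 p hp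
    · intro p hp q hq
      rcases mem_insert.1 hp with rfl | hp <;> rcases mem_insert.1 hq with rfl | hq
      · simp
      · have := hS.1 q hq
        simp only; omega
      · have := hS.1 p hp
        simp only; omega
      · exact hS.2.1 p hp q hq
    · intro v
      rw [deg_insert _ _ _ _ hn]
      have := hS.2.2 v
      unfold decr at this
      by_cases e1 : v = a <;> by_cases e2 : v = k
      · omega
      · subst e1; simp [e2] at this ⊢; omega
      · subst e2; simp [e1] at this ⊢; omega
      · simp [e1, e2, Ne.symm e1, Ne.symm e2] at this ⊢; omega
    · rw [card_insert_of_notMem hn]; omega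
    · exact mem_insert_self _ _
    · intro j hj
      rcases mem_insert.1 hj with h | h
      · simp at h; omega
      · have := hS.1 _ h
        simp at this; omega
  · intro A hA
    rw [mem_coe, mem_filter, mem_F] at hA
    exact insert_erase hA.2.1
  · intro B hB
    rw [mem_coe, mem_filter, mem_F] at hB
    exact erase_insert hB.2

abbrev one : ℕ → ℕ := fun _ => 1

lemma Stk.one_of_decr {c : ℕ → ℕ} {a b : ℕ} {A : Finset (ℕ × ℕ)} (h : Stk c a b A)
    (h0 : c a = 0) (h1 : ∀ v, a < v → v < b → c v = 1) : Stk one (a+1) b A := by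
  have h3 := h.2.2 a
  rw [h0] at h3
  exact (h.down fun k hk => (deg_pos (Nat.le_zero.1 h3) hk).1 rfl).congr
    fun v hv hv2 => (h1 v (by omega) hv2).le

lemma boundU (L : ℕ) : ∀ (a b : ℕ) (A : Finset (ℕ × ℕ)), b = a + L → Stk (cU b) a b A →
    2 * A.card ≤ L := by
  induction L using Nat.strong_induction_on with
  | _ L ih =>
    intro a b A hb hA
    by_cases h0 : ∀ k, (a, k) ∉ A
    · rcases Nat.eq_zero_or_pos L with rfl | hL
      · have : A = ∅ := eq_empty_of_forall_notMem fun p hp => by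
          have := hA.1 p hp
          omega
        subst this; simp
      · have := ih (L-1) (by omega) (a+1) b A (by omega) (hA.down h0)
        omega
    · obtain ⟨k, hk, hkb, ht⟩ := exists_top hA h0
      by_cases hl : k + 1 = b
      · have h1 := hA.erase ht.1 (by omega)
        have h2 := h1.one_of_decr (by simp only [decr, cU, one]; split_ifs <;> omega)
          (fun v _ _ => by simp only [decr, cU, one]; split_ifs <;> omega)
        have h3 := bound1' h2
        have := card_erase_add_one ht.1
        omega
      have hg := hA.inn_out ht (by simp [cU, hl])
      have hi := hA.inn ht
      have ho := hA.out (k := k)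
      have hc := card_glue hi ho (by omega)
      rw [← hg] at hc
      have hi2 := hi.one_of_decr (by simp only [decr, cU, one]; split_ifs <;> omega)
          (fun v _ _ => by simp only [decr, cU, one]; split_ifs <;> omega)
      have h1 := bound1' hi2
      have h2 := ih (b-k-1) (by omega) (k+1) b _ (by omega) ho
      omega

lemma boundU' {a b : ℕ} {A : Finset (ℕ × ℕ)} (h : Stk (cU b) a b A) :
    2 * A.card ≤ b - a := by
  by_cases hab : a ≤ b
  · have := boundU (b - a) a b A (by omega) h
    omega
  · have : A = ∅ := eq_empty_of_forall_notMem fun p hp => by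
      have := h.1 p hp
      omega
    subst this; simp

lemma F_self (c : ℕ → ℕ) (a d : ℕ) : (F c a a d).card = if d = 0 then 1 else 0 := by
  split_ifs with h
  · subst h
    rw [card_eq_one]
    refine ⟨∅, ?_⟩
    ext A
    rw [mem_F, mem_singleton]
    constructor
    · intro h
      rw [← card_eq_zero]; omega
    · rintro rfl
      refine ⟨⟨by simp, by simp, fun v => ?_⟩, by simp⟩
      simp [arcDegree]
  · rw [card_eq_zero]
    refine eq_empty_of_forall_notMem fun A hA => ?_
    rw [mem_F] at hA
    omega

lemma F_parity (c : ℕ → ℕ) (a b d : ℕ) (h : (a + b + d) % 2 = 1) : (F c a b d).card = 0 := by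
  rw [card_eq_zero]
  refine eq_empty_of_forall_notMem fun A hA => ?_
  rw [mem_F] at hA
  omega

lemma cS0 (a b : ℕ) (h : a < b) : (F one a b 0).card = 0 := by
  rw [card_eq_zero]
  refine eq_empty_of_forall_notMem fun A hA => ?_
  rw [mem_F] at hA
  have := (bound1' hA.1).2 h
  omega

open Classical in
lemma P_top (c : ℕ → ℕ) (a b d k : ℕ) (hak : a + 2 ≤ k) (hkb : k < b)
    (hc : ∀ v, a ≤ v → v ≤ k → c v = 1)
    (h2 : ∀ A, Stk c (k+1) b A → 2 * A.card ≤ b - (k + 1)) :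
    ((F c a b d).filter (TopArc a k)).card =
      ∑ ij ∈ HasAntidiagonal.antidiagonal d, (F one (a+1) k ij.1).card * (F c (k+1) b ij.2).card := by
  have d0 : decr c a a = 0 := by simp [decr, hc a le_rfl (by omega)]
  have d1 : ∀ v, a < v → v < k → decr c a v = 1 := fun v h1 h2 => by
    simp only [decr]
    rw [if_neg (by omega), hc v (by omega) (by omega)]
  have hb : ∀ A, Stk (decr c a) a k A → 2 * A.card + 1 ≤ k - a := fun A hA => by
    have := bound1' (hA.one_of_decr d0 d1)
    omega
  rw [F_top c a b d k hak hkb (by rw [hc] <;> omega) (hc k (by omega) le_rfl)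
    (fun A hA => by have := hb A hA; omega) h2]
  rw [Finset.Nat.antidiagonal_succ, sum_cons, sum_map]
  have e0 : F (decr c a) a k 0 = ∅ := by
    refine eq_empty_of_forall_notMem fun A hA => ?_
    rw [mem_F] at hA
    have := hb A hA.1
    omega
  simp only [e0, card_empty, zero_mul, zero_add]
  refine sum_congr rfl fun ij _ => ?_
  simp only [Function.Embedding.prodMap, Function.Embedding.coeFn_mk, Prod.map,
    Function.Embedding.refl_apply, Nat.succ_eq_add_one]
  rw [F_zero _ _ _ _ d0, F_congr (c' := one) fun v h1 h2 => d1 v (by omega) h2]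

open Classical in
lemma S_top (a b d k : ℕ) (hak : a + 2 ≤ k) (hkb : k < b) :
    ((F one a b d).filter (TopArc a k)).card =
      ∑ ij ∈ HasAntidiagonal.antidiagonal d,
        (F one (a+1) k ij.1).card * (F one (k+1) b ij.2).card :=
  P_top one a b d k hak hkb (fun _ _ _ => rfl) (fun _ hA => (bound1' hA).1)

open Classical in
lemma U_top (a b d k : ℕ) (hak : a + 2 ≤ k) (hkb : k + 1 < b) :
    ((F (cU b) a b d).filter (TopArc a k)).card =
      ∑ ij ∈ HasAntidiagonal.antidiagonal d,
        (F one (a+1) k ij.1).card * (F (cU b) (k+1) b ij.2).card :=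
  P_top (cU b) a b d k hak (by omega) (fun _ _ _ => by simp only [cU]; split_ifs <;> omega)
    (fun _ hA => (boundU' hA))

open Classical in
lemma U_last (a k d : ℕ) (hak : a + 2 ≤ k) :
    ((F (cU (k+1)) a (k+1) d).filter (TopArc a k)).card = (F one (a+1) (k+1) (d+1)).card := by
  rw [F_last _ _ _ _ hak (by simp only [cU]; split_ifs <;> omega) (by simp [cU])]
  rw [F_zero _ _ _ _ (by simp only [decr, cU, one]; split_ifs <;> omega)]
  rw [F_congr (c' := one) (fun v _ _ => by simp only [decr, cU, one]; split_ifs <;> omega)]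
  congr 1
  rw [filter_eq_self]
  intro A hA h
  have := (mem_F.1 hA).1.1 _ h
  simp at this

open Classical in
lemma S_last (a k d : ℕ) (hak : a + 2 ≤ k) :
    ((F one a (k+1) d).filter (TopArc a k)).card = (F one (a+1) k d).card := by
  rw [S_top _ _ _ _ hak (by omega)]
  simp only [F_self]
  rw [Finset.sum_eq_single (d, 0)]
  · simp
  · rintro ⟨i, j⟩ h1 h2
    rw [HasAntidiagonal.mem_antidiagonal] at h1
    have : j ≠ 0 := by
      rintro rfl
      apply h2
      simp at h1
      simp [h1]
    simp [this]
  · intro h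
    simp at h

open Classical in
noncomputable def Sp (a n d : ℕ) : ℕ := ((F one a (n+1) d).filter (fun B => (a, n) ∉ B)).card

open Classical in
lemma Sp_eq (a n d : ℕ) (h : a + 2 ≤ n) : (F one a (n+1) d).card = Sp a n d + (F one (a+1) n d).card := by
  rw [← S_last a n d h, Sp, ← card_filter_add_card_filter_not (fun B => (a, n) ∉ B)]
  congr 2
  ext A
  simp only [mem_filter, not_not]
  refine and_congr_right fun hA => ⟨fun h => ⟨h, fun j hj => ?_⟩, fun h => h.1⟩
  have := (mem_F.1 hA).1.1 _ hj
  simp at this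
  omega

open Classical in
lemma Sp_rec (a n d : ℕ) (h : a + 2 ≤ n) : Sp a n (d+1) = (F one (a+1) (n+1) d).card +
    ∑ k ∈ Ico (a+2) n, ∑ ij ∈ HasAntidiagonal.antidiagonal (d+1),
        (F one (a+1) k ij.1).card * (F one (k+1) (n+1) ij.2).card := by
  have h1 := Sp_eq a n (d+1) h
  rw [F_fiber, F_noarc, sum_Ico_succ_top h, S_last a n _ h] at h1
  rw [sum_congr rfl fun k hk => S_top a (n+1) (d+1) k (by rw [mem_Ico] at hk; omega)
    (by rw [mem_Ico] at hk; omega)] at h1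
  omega

def cE (n : ℕ) : ℕ → ℕ := fun v => if v = 1 ∨ v = n then 2 else 1

open Classical in
lemma E_rec (n d : ℕ) (h : 5 ≤ n) : (F (cE n) 1 (n+1) d).card =
    (if d = 0 then 0 else (F (cU (n+1)) 2 (n+1) (d-1)).card) +
    ∑ k ∈ Ico 3 n, ∑ ij ∈ HasAntidiagonal.antidiagonal (d+1),
        (F one 1 k ij.1).card * (F (cU (n+1)) (k+1) (n+1) ij.2).card + Sp 1 n (d+2) := by
  have hEU : ∀ v, 2 ≤ v → cE n v = cU (n+1) v := fun v _ => by
    simp only [cE, cU]; split_ifs <;> omega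
  have hB : ∀ k A, 1 ≤ k → Stk (cE n) (k+1) (n+1) A → 2 * A.card ≤ n + 1 - (k+1) :=
    fun k A hk hA => boundU' (hA.congr fun v _ _ => (hEU v (by omega)).le)
  rw [F_fiber, sum_Ico_succ_top (by omega), F_last _ _ _ _ (by omega) (by simp [cE])
    (by simp [cE]), ← add_assoc]
  congr 1
  · congr 1
    · split_ifs with hd
      · subst hd
        rw [F_noarc0 _ _ _ (fun A hA => hB 1 A le_rfl hA) (by omega), card_empty]
      · obtain ⟨e, rfl⟩ : ∃ e, d = e + 1 := ⟨d - 1, by omega⟩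
        rw [F_noarc, F_congr (c' := cU (n+1)) fun v hv _ => hEU v hv]
        rfl
    · refine sum_congr rfl fun k hk => ?_
      rw [mem_Ico] at hk
      rw [F_top _ _ _ _ _ (by omega) (by omega) (by simp [cE])
        (by simp only [cE]; split_ifs <;> omega)
        (fun A hA => (bound1' (hA.congr fun v _ _ => by
          simp only [cE, decr, one]; split_ifs <;> omega)).1)
        (fun A hA => hB k A (by omega) hA)]
      refine sum_congr rfl fun ij _ => ?_
      rw [F_congr (c' := one) (fun v _ _ => by simp only [cE, decr, one]; split_ifs <;> omega)]
      rw [F_congr (c := cE n) fun v hv _ => hEU v (by omega)]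
  · rw [Sp, F_congr (c' := one) (fun v _ _ => by simp only [cE, decr, one]; split_ifs <;> omega)]

lemma ELO_eq (n : ℕ) (h : 5 ≤ n) : ELO0 n = (F (cE n) 1 (n+1) (n%2)).card := by
  unfold ELO0
  apply Nat.subtype_card
  intro A
  rw [mem_F]
  have : (2 * #A + n % 2 + 1 = n + 1) ↔ #A = n / 2 := by omega
  rw [this]
  refine and_congr_left fun _ => ⟨?_, ?_⟩
  · intro H
    have d1 := H.2.2 1
    have dn := H.2.2 n
    refine ⟨fun p hp => ?_, H.2.1, fun v h1 h2 => ?_, ?_, ?_⟩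
    · have := H.1 p hp
      omega
    · have := H.2.2 v
      rwa [cE, if_neg (by omega)] at this
    · simpa [cE] using d1
    · simpa [cE] using dn
  · intro H
    refine ⟨fun p hp => ?_, H.2.1, fun v => ?_⟩
    · have := H.1 p hp
      omega
    · by_cases h1 : 1 ≤ v ∧ v ≤ n
      · simp only [cE]
        split_ifs with hv
        · rcases hv with rfl | rfl
          · exact H.2.2.2.1
          · exact H.2.2.2.2
        · exact H.2.2.1 v (by omega) (by omega)
      · rw [deg_zero]
        · exact Nat.zero_le _
        · intro p hp
          have := H.1 p hp
          omega

lemma sum_even (f : ℕ → ℕ) (t : ℕ) :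
    ∑ x ∈ range (2*t), f x = ∑ y ∈ range t, (f (2*y) + f (2*y+1)) := by
  induction t with
  | zero => simp
  | succ t ih =>
    rw [show 2 * (t+1) = 2*t+1+1 by ring, sum_range_succ, sum_range_succ, ih, sum_range_succ]
    ring

def T : ℕ → ℕ
  | 0 => 0
  | t+1 => T t + (t+1)

lemma F_short (c : ℕ → ℕ) (a d : ℕ) : (F c a (a+1) (d+1)).card = if d = 0 then 1 else 0 := by
  rw [F_fiber, F_noarc, Ico_eq_empty_of_le (by omega), F_self]
  simp

lemma F_short2 (c : ℕ → ℕ) (a d : ℕ) : (F c a (a+2) (d+1)).card = (F c (a+1) (a+2) d).card := by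
  rw [F_fiber, F_noarc, Ico_eq_empty_of_le (by omega)]
  simp

lemma anti1 (f : ℕ × ℕ → ℕ) : ∑ ij ∈ HasAntidiagonal.antidiagonal 1, f ij = f (0,1) + f (1,0) := by
  simp [Finset.Nat.antidiagonal_succ]
lemma anti2 (f : ℕ × ℕ → ℕ) :
    ∑ ij ∈ HasAntidiagonal.antidiagonal 2, f ij = f (0,2) + f (1,1) + f (2,0) := by
  simp [Finset.Nat.antidiagonal_succ]; ring
lemma anti3 (f : ℕ × ℕ → ℕ) :
    ∑ ij ∈ HasAntidiagonal.antidiagonal 3, f ij = f (0,3) + f (1,2) + f (2,1) + f (3,0) := by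
  simp [Finset.Nat.antidiagonal_succ]; ring

lemma cS1_odd (t : ℕ) : ∀ a, (F one a (a+2*t+1) 1).card = 1 := by
  induction t with
  | zero => intro a; exact F_short _ _ _
  | succ t ih =>
    intro a
    rw [show a + 2*(t+1)+1 = (a+2*t+2)+1 by ring, Sp_eq _ _ _ (by omega), Sp_rec _ _ _ (by omega)]
    rw [cS0 _ _ (by omega), sum_eq_zero]
    · have := ih (a+1)
      rw [show a+1+2*t+1 = a+2*t+2 by ring] at this
      omega
    · intro k hk
      rw [mem_Ico] at hk
      rw [anti1]
      simp only
      rw [cS0 _ _ (by omega), cS0 _ _ (by omega)]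
      simp

lemma cS1 (a b : ℕ) (h : a ≤ b) : (F one a b 1).card = (b - a) % 2 := by
  rcases Nat.mod_two_eq_zero_or_one (b - a) with h1 | h1
  · rw [h1, F_parity]
    omega
  · rw [h1]
    have := cS1_odd ((b-a)/2) a
    rwa [show a + 2 * ((b-a)/2) + 1 = b by omega] at this

lemma Sp2 (a t : ℕ) : Sp a (a+2*t+3) 2 = t + 2 := by
  rw [Sp_rec _ _ _ (by omega), cS1 _ _ (by omega)]
  rw [sum_congr rfl (g := fun k => (k - a - 1) % 2)]
  · rw [sum_Ico_eq_sum_range, show a + 2*t+3 - (a+2) = 2 * t + 1 by omega, sum_range_succ, sum_even]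
    rw [sum_congr rfl (g := fun _ => 1)]
    · simp; omega
    · intro y _
      omega
  · intro k hk
    rw [mem_Ico] at hk
    rw [anti2]
    simp only
    rw [cS0 _ _ (by omega), cS0 _ _ (by omega), cS1 _ _ (by omega), cS1 _ _ (by omega)]
    rw [show (a + 2*t+3+1 - (k+1))%2 = (k - (a+1))%2 by omega, Nat.sub_sub]
    rcases Nat.mod_two_eq_zero_or_one (k - (a+1)) with h | h <;> simp [h]

lemma cS2 (t : ℕ) : ∀ a b, b = a + 2*t → (F one a b 2).card = T t := by
  induction t with
  | zero => rintro a b rfl; simp [F_self, T]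
  | succ t ih =>
    rintro a b rfl
    cases t with
    | zero =>
      rw [show a + 2*(0+1) = a+2 by ring, F_short2, F_short]
      simp [T]
    | succ t =>
      rw [show a + 2*(t+1+1) = a+2*t+3+1 by ring, Sp_eq _ _ _ (by omega), Sp2,
        ih (a+1) _ (by omega)]
      simp only [T]
      omega

lemma cU0 (a b : ℕ) (h : a < b) :
    (F (cU b) a b 0).card = if (b - a) % 2 = 0 ∧ 4 ≤ b - a then 1 else 0 := by
  classical
  rw [F_fiber, F_noarc0 _ _ _ (fun A hA => boundU' hA) h, card_empty, zero_add]
  by_cases h3 : b < a + 3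
  · rw [Ico_eq_empty_of_le (by omega), if_neg (by omega)]
    simp
  · obtain ⟨k, rfl⟩ : ∃ k, b = k + 1 := ⟨b - 1, by omega⟩
    rw [sum_Ico_succ_top (by omega), U_last _ _ _ (by omega), cS1 _ _ (by omega), sum_eq_zero]
    · split_ifs <;> omega
    · intro l hl
      rw [mem_Ico] at hl
      rw [U_top _ _ _ _ (by omega) (by omega)]
      simp only [HasAntidiagonal.antidiagonal_zero, sum_singleton]
      rw [cS0 _ _ (by omega), zero_mul]

lemma sum_ind (f : ℕ → ℕ) (t : ℕ) (q : ℕ) (hq : q ≤ t) :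
    ∑ y ∈ range t, (if y < q then f y else 0) = ∑ y ∈ range q, f y := by
  rw [← sum_filter]
  congr 1
  ext y
  simp
  omega

lemma cU1 (r a b : ℕ) (h : b = a + 2*r+1) :
    (F (cU b) a b 1).card = if r = 0 then 1 else r - 1 + T r := by
  classical
  subst h
  rcases Nat.eq_zero_or_pos r with rfl | hr
  · exact F_short _ _ _
  rw [F_fiber, F_noarc, cU0 _ _ (by omega), sum_Ico_succ_top (by omega), U_last _ _ _ (by omega),
    cS2 r _ _ (by omega), if_neg (show r ≠ 0 by omega)]
  rw [sum_congr rfl (g := fun k => if (k - a) % 2 = 0 ∧ k + 4 ≤ a + 2*r then 1 else 0)]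
  · rw [sum_Ico_eq_sum_range, show a + 2*r - (a+2) = 2 * (r-1) by omega, sum_even]
    rw [sum_congr rfl (g := fun y => if y < r - 2 then 1 else 0)]
    · rw [sum_ind (fun _ => 1) _ _ (by omega)]
      simp
      split_ifs <;> omega
    · intro y _
      split_ifs <;> omega
  · intro k hk
    rw [mem_Ico] at hk
    rw [U_top _ _ _ _ (by omega) (by omega), anti1]
    simp only
    rw [cS0 _ _ (by omega), cS1 _ _ (by omega), cU0 _ _ (by omega)]
    rcases Nat.mod_two_eq_zero_or_one (k - (a+1)) with h | h <;> rw [h] <;> split_ifs <;> omega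

lemma E_even (q : ℕ) : (F (cE (2*q+6)) 1 (2*q+6+1) 0).card = 2 * q + 3 := by
  rw [E_rec _ _ (by omega)]
  have := Sp2 1 (q+1)
  rw [show 1 + 2*(q+1)+3 = 2*q+6 by ring] at this
  rw [this]
  rw [sum_congr rfl (g := fun k => if k % 2 = 0 ∧ k + 4 ≤ 2*q+6 then 1 else 0)]
  · rw [sum_Ico_eq_sum_range, show 2*q+6-3 = 2 * (q+1)+1 by omega, sum_range_succ, sum_even]
    rw [sum_congr rfl (g := fun y => if y < q then 1 else 0)]
    · rw [sum_ind (fun _ => 1) _ _ (by omega)]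
      simp
      omega
    · intro y _
      split_ifs <;> omega
  · intro k hk
    rw [mem_Ico] at hk
    rw [anti1]
    simp only
    rw [cS0 _ _ (by omega), cS1 _ _ (by omega), cU0 _ _ (by omega)]
    rcases Nat.mod_two_eq_zero_or_one (k - 1) with h | h <;> rw [h] <;> split_ifs <;> omega

def Q (m : ℕ) : ℕ := ∑ y ∈ range m, T (y+1)

lemma Q_reflect (m : ℕ) : ∑ y ∈ range m, T (m - y) = Q m := by
  rw [Q, ← sum_range_reflect]
  refine sum_congr rfl fun y hy => ?_
  rw [mem_range] at hy
  congr 1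
  omega

lemma Sp3 (q : ℕ) : Sp 1 (2*q+5) 3 = T (q+2) + 2 * Q (q+1) := by
  rw [Sp_rec _ _ _ (by omega), cS2 (q+2) _ _ (by omega)]
  congr 1
  rw [sum_Ico_eq_sum_range, show 2*q+5-(1+2) = 2 * (q+1) by omega, sum_even]
  rw [sum_congr rfl (g := fun y => T (q+1-y) + T (y+1))]
  · rw [sum_add_distrib, Q_reflect, ← Q]; ring
  · intro y hy
    rw [mem_range] at hy
    rw [anti3, anti3]
    simp only
    congr 1
    · rw [cS0 _ _ (by omega), cS1 _ _ (by omega), cS2 (q+1-y) _ _ (by omega),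
        F_parity _ _ _ 2 (by omega), cS0 _ _ (by omega)]
      rw [show (1 + 2 + 2 * y - (1+1)) % 2 = 1 by omega]
      simp
    · rw [cS0 _ _ (by omega), cS1 _ _ (by omega), cS2 (y+1) (1+1) (1+2+(2*y+1)) (by omega),
        cS0 _ _ (by omega), cS1 _ _ (by omega)]
      rw [show (1 + 2 + (2 * y + 1) - (1+1)) % 2 = 0 by omega,
        show (2*q+5+1 - (1 + 2 + (2 * y + 1) + 1)) % 2 = 1 by omega]
      simp

lemma E_odd (q : ℕ) : (F (cE (2*q+5)) 1 (2*q+5+1) 1).card =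
    2 + ∑ r ∈ range q, (r + T (r+1)) + Q q + T (q+2) + 2 * Q (q+1) := by
  rw [E_rec _ _ (by omega), Sp3, if_neg (by omega), cU0 _ _ (by omega), if_pos (by omega)]
  rw [sum_Ico_eq_sum_range, show 2*q+5-3 = 2 * (q+1) by omega, sum_even]
  rw [sum_congr rfl (g := fun y => (if y < q then T (y+1) else 0) +
    (if q - y = 0 then 1 else (q - y) - 1 + T (q - y)))]
  · rw [sum_add_distrib, sum_ind (fun y => T (y+1)) _ _ (by omega), ← Q]
    rw [sum_range_succ (fun y => (if q - y = 0 then 1 else (q - y) - 1 + T (q - y)))]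
    rw [← sum_range_reflect (fun r => r + T (r+1))]
    rw [sum_congr rfl (g := fun y => (q - 1 - y) + T (q - 1 - y + 1))]
    · simp
      ring
    · intro y hy
      rw [mem_range] at hy
      rw [if_neg (by omega), show q - 1 - y + 1 = q - y by omega]
      omega
  · intro y hy
    rw [mem_range] at hy
    rw [anti2, anti2]
    simp only
    congr 1
    · rw [cS0 _ _ (by omega), F_parity one _ _ 1 (by omega), cS2 (y+1) _ _ (by omega),
        cU0 _ _ (by omega)]
      split_ifs <;> first | omega | simp
    · rw [cS0 _ _ (by omega), cS1 _ _ (by omega), cU1 (q-y) _ _ (by omega),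
        F_parity one _ _ 2 (by omega)]
      rw [show (3 + (2 * y + 1) - 1) % 2 = 1 by omega]
      simp

lemma T_val (t : ℕ) : (T t : ℚ) = t * (t+1) / 2 := by
  induction t with
  | zero => simp [T]
  | succ t ih => simp only [T]; push_cast; rw [ih]; ring

lemma Q_val (t : ℕ) : (Q t : ℚ) = t * (t+1) * (t+2) / 6 := by
  induction t with
  | zero => simp [Q]
  | succ t ih =>
    have : Q (t+1) = Q t + T (t+1) := sum_range_succ _ _
    rw [this]; push_cast; rw [ih, T_val]; push_cast; ring

lemma R_val (q : ℕ) : ((∑ r ∈ range q, (r + T (r+1)) : ℕ) : ℚ) =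
    q * (q - 1) / 2 + q * (q+1) * (q+2) / 6 := by
  induction q with
  | zero => simp
  | succ q ih =>
    rw [sum_range_succ, Nat.cast_add, ih]; push_cast; rw [T_val]; push_cast; ring

end ELO

theorem stmt17 (n : ℕ) (hn : 5 ≤ n) :
    (Even n → ELO0 n = n - 3) ∧
    (Odd n → (ELO0 n : ℚ) =
      ((n : ℚ) ^ 3 - 3 * (n : ℚ) ^ 2 - 7 * (n : ℚ) + 69) / 12) := by
  rw [ELO.ELO_eq n hn]
  constructor
  · rintro ⟨m, hm⟩
    obtain ⟨q, rfl⟩ : ∃ q, n = 2 * q + 6 := ⟨m - 3, by omega⟩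
    rw [show (2 * q + 6) % 2 = 0 by omega, ELO.E_even]
    omega
  · rintro ⟨m, hm⟩
    obtain ⟨q, rfl⟩ : ∃ q, n = 2 * q + 5 := ⟨m - 2, by omega⟩
    rw [show (2 * q + 5) % 2 = 1 by omega, ELO.E_odd]
    rw [Nat.cast_add, Nat.cast_add, Nat.cast_add, Nat.cast_add, ELO.R_val, Nat.cast_mul,
      ELO.Q_val, ELO.Q_val, ELO.T_val]
    push_cast
    ring
end
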